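/- For every integer n ≥ 71, p(n)² − p(n−1)·p(n+1) − p(n)·p(n+1) + p(n+1)² + p(n−1)·p(n+2) − p(n)·p(n+2) > 0. -/

import Mathlib

/-- The partition function: the number of partitions of `n`. -/
def partitionFn (n : ℕ) : ℕ := Fintype.card (Nat.Partition n)

section GeneratingFunction

open PowerSeries

/-- The generating function of the partition numbers. -/
noncomputable def partitionSeries (R : Type*) [CommRing R] : R⟦X⟧ :=
  PowerSeries.mk fun n ↦ (partitionFn n : R)

/-- Euler's generating function identity, combined with the pentagonal number theorem. -/
theorem partitionSeries_mul_pentagonalSeries (R : Type*) [CommRing R] :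
    partitionSeries R * pentagonalSeries R = 1 := by
  rcases subsingleton_or_nontrivial R with _ | _
  · exact Subsingleton.elim _ _
  let : TopologicalSpace R := ⊥
  have : DiscreteTopology R := ⟨rfl⟩
  open scoped PowerSeries.WithPiTopology in
  have h1 := Nat.Partition.hasProd_powerSeriesMk_card_restricted R (fun _ ↦ True)
  open scoped PowerSeries.WithPiTopology in
  have h2 := h1.mul (WithPiTopology.hasProd_one_sub_X_pow R)
  have h3 : (PowerSeries.mk fun n ↦ ((Nat.Partition.restricted n fun _ ↦ True).card : R))
      = partitionSeries R := by
    ext n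
    simp [partitionSeries, Nat.Partition.restricted, partitionFn]
  rw [h3] at h2
  refine h2.unique ?_
  convert! hasProd_one with i
  simp only [if_true, pow_mul]
  exact WithPiTopology.tsum_pow_mul_one_sub_of_constantCoeff_eq_zero (by simp)

/-- Modulo `X ^ (n + 1)`, the series `(1 - X) * ∑ p(m) X ^ m` agrees with the finite products
`∏ k ∈ [2, L + 1], 1 / (1 - X ^ k)` once `L` is large. -/
theorem eventually_coeff_eq_coeff_one_sub_X_mul_partitionSeries (R : Type*) [CommRing R] (n : ℕ) :
    ∀ᶠ L : ℕ in Filter.atTop, ∀ Q : R⟦X⟧, Q * ∏ k ∈ Finset.range L, (1 - X ^ (k + 2)) = 1 →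
      ∀ m ≤ n, coeff m Q = coeff m ((1 - X) * partitionSeries R) := by
  have h1 : ∀ᶠ L : ℕ in Filter.atTop, ∀ m ∈ Finset.range (n + 1),
      (∏ k ∈ Finset.range (L + 1), (1 - X ^ (k + 1) : R⟦X⟧)).coeff m
        = (pentagonalSeries R).coeff m := by
    rw [Filter.eventually_all_finset]
    exact fun m _ ↦ (Filter.tendsto_finset_range.comp (Filter.tendsto_add_atTop_nat 1)).eventually
      (coeff_prod_one_sub_X_pow_eventually_eq R m)
  filter_upwards [h1] with L hL Q hQ m hm
  have h2 : (X : R⟦X⟧) ^ (n + 1) ∣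
      ∏ k ∈ Finset.range (L + 1), (1 - X ^ (k + 1) : R⟦X⟧) - pentagonalSeries R := by
    rw [X_pow_dvd_iff]
    intro m hm
    rw [map_sub, hL m (Finset.mem_range.2 hm), sub_self]
  have h3 : Q - (1 - X) * partitionSeries R = -(Q * partitionSeries R) *
      (∏ k ∈ Finset.range (L + 1), (1 - X ^ (k + 1) : R⟦X⟧) - pentagonalSeries R) := by
    rw [Finset.prod_range_succ']
    linear_combination (1 - X) * partitionSeries R * hQ
      - Q * (partitionSeries_mul_pentagonalSeries R)
  have h4 := X_pow_dvd_iff.1 (h3 ▸ Dvd.dvd.mul_left h2 _) m (by omega)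
  rwa [map_sub, sub_eq_zero] at h4

theorem coeff_succ_one_sub_X_mul_partitionSeries (R : Type*) [CommRing R] (n : ℕ) :
    coeff (n + 1) ((1 - X) * partitionSeries R)
      = (partitionFn (n + 1) : R) - (partitionFn n : R) := by
  simp [sub_mul, partitionSeries, coeff_succ_X_mul]

/-- Absolute convergence of a power series at `z`, with value `w`. -/
def AbsHasSumAt (φ : ℂ⟦X⟧) (z w : ℂ) : Prop :=
  Summable (fun m ↦ ‖coeff m φ * z ^ m‖) ∧ ∑' m, coeff m φ * z ^ m = w

theorem AbsHasSumAt.mul {φ ψ : ℂ⟦X⟧} {z w₁ w₂ : ℂ} (h₁ : AbsHasSumAt φ z w₁)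
    (h₂ : AbsHasSumAt ψ z w₂) : AbsHasSumAt (φ * ψ) z (w₁ * w₂) := by
  have key (m : ℕ) : coeff m (φ * ψ) * z ^ m =
      ∑ kl ∈ Finset.HasAntidiagonal.antidiagonal m,
        coeff kl.1 φ * z ^ kl.1 * (coeff kl.2 ψ * z ^ kl.2) := by
    rw [coeff_mul, Finset.sum_mul]
    refine Finset.sum_congr rfl fun kl hkl ↦ ?_
    rw [← Finset.HasAntidiagonal.mem_antidiagonal.1 hkl]
    ring
  refine ⟨?_, ?_⟩
  · refine (summable_norm_sum_mul_antidiagonal_of_summable_norm h₁.1 h₂.1).congr fun m ↦ ?_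
    rw [key m]
  · rw [tsum_congr key, ← tsum_mul_tsum_eq_tsum_sum_antidiagonal_of_summable_norm h₁.1 h₂.1,
      h₁.2, h₂.2]

/-- The series `1 / (1 - X ^ (k + 1))`. -/
noncomputable def geomSeries (k : ℕ) : ℂ⟦X⟧ := PowerSeries.mk fun m ↦ if k + 1 ∣ m then 1 else 0

theorem geomSeries_mul_one_sub_X_pow (k : ℕ) : geomSeries k * (1 - X ^ (k + 1)) = 1 := by
  ext m
  rw [mul_sub, mul_one, map_sub, coeff_mul_X_pow', coeff_one]
  simp only [geomSeries, coeff_mk]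
  rcases lt_or_ge m (k + 1) with h | h
  · have h1 : k + 1 ∣ m ↔ m = 0 :=
      ⟨fun h' ↦ Nat.eq_zero_of_dvd_of_lt h' h, fun h' ↦ h' ▸ dvd_zero _⟩
    simp [h1, h.not_ge]
  · have h1 : k + 1 ∣ m - (k + 1) ↔ k + 1 ∣ m := by
      rw [Nat.dvd_sub_iff_left h dvd_rfl]
    have h2 : m ≠ 0 := by omega
    simp [h1, h, h2]

theorem absHasSumAt_geomSeries (k : ℕ) {z : ℂ} (hz : ‖z‖ < 1) :
    AbsHasSumAt (geomSeries k) z (1 - z ^ (k + 1))⁻¹ := by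
  have hz' : ‖z ^ (k + 1)‖ < 1 := by
    rw [norm_pow]
    exact pow_lt_one₀ (norm_nonneg _) hz (by omega)
  have hinj : Function.Injective fun j ↦ (k + 1) * j :=
    fun a b h ↦ Nat.eq_of_mul_eq_mul_left (Nat.succ_pos k) h
  have hsupp : Function.support (fun m ↦ coeff m (geomSeries k) * z ^ m)
      ⊆ Set.range fun j ↦ (k + 1) * j := by
    intro m hm
    by_contra h
    refine hm ?_
    have : ¬ k + 1 ∣ m := fun ⟨j, hj⟩ ↦ h ⟨j, hj.symm⟩
    simp [geomSeries, this]
  have hcomp : (fun m ↦ coeff m (geomSeries k) * z ^ m) ∘ (fun j ↦ (k + 1) * j)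
      = fun j ↦ (z ^ (k + 1)) ^ j := by
    ext j
    simp [geomSeries, pow_mul]
  refine ⟨?_, ?_⟩
  · refine Summable.of_norm_bounded (summable_geometric_of_lt_one (norm_nonneg z) hz) fun m ↦ ?_
    simp only [geomSeries, coeff_mk, norm_norm]
    split_ifs <;> simp
  · rw [← hinj.tsum_eq hsupp]
    have := tsum_geometric_of_norm_lt_one hz'
    rw [← this]
    exact tsum_congr fun j ↦ congrFun hcomp j

/-- The generating function of partitions into parts in `[2, L + 1]`. -/
noncomputable def partsSeries (L : ℕ) : ℂ⟦X⟧ := ∏ k ∈ Finset.range L, geomSeries (k + 1)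

theorem partsSeries_mul_prod (L : ℕ) :
    partsSeries L * ∏ k ∈ Finset.range L, (1 - X ^ (k + 2)) = 1 := by
  rw [partsSeries, ← Finset.prod_mul_distrib]
  exact Finset.prod_eq_one fun k _ ↦ geomSeries_mul_one_sub_X_pow (k + 1)

theorem absHasSumAt_partsSeries (L : ℕ) {z : ℂ} (hz : ‖z‖ < 1) :
    AbsHasSumAt (partsSeries L) z (∏ k ∈ Finset.range L, (1 - z ^ (k + 2))⁻¹) := by
  induction L with
  | zero =>
    refine ⟨(hasSum_single 0 fun m hm ↦ ?_).summable, (tsum_eq_single 0 fun m hm ↦ ?_).trans ?_⟩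
      <;> simp_all [partsSeries, coeff_one]
  | succ L ih =>
    rw [partsSeries, Finset.prod_range_succ, Finset.prod_range_succ]
    exact ih.mul (absHasSumAt_geomSeries (L + 1) hz)

end GeneratingFunction

section Fourier

open Complex MeasureTheory intervalIntegral

theorem integral_exp_int_mul_I (j : ℤ) :
    ∫ θ in (-Real.pi)..Real.pi, exp (j * θ * I) = if j = 0 then 2 * (Real.pi : ℂ) else 0 := by
  split_ifs with h
  · simp only [h, Int.cast_zero, zero_mul, exp_zero, intervalIntegral.integral_const]
    simp [two_mul]
  · have hj : (j : ℂ) * I ≠ 0 := mul_ne_zero (Int.cast_ne_zero.2 h) I_ne_zero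
    have h1 := integral_exp_mul_complex (a := -Real.pi) (b := Real.pi) hj
    have h2 : exp (j * I * (Real.pi : ℂ)) = exp (j * I * ((-Real.pi : ℝ) : ℂ)) := by
      rw [exp_eq_exp_iff_exists_int]
      exact ⟨j, by push_cast; ring⟩
    rw [h2, sub_self, zero_div] at h1
    rw [← h1]
    exact integral_congr fun θ _ ↦ by ring_nf

/-- The Fourier series with absolutely summable coefficients `a`. -/
noncomputable def fourierSum (a : ℕ → ℂ) (θ : ℝ) : ℂ := ∑' m, a m * exp (m * θ * I)

variable {a : ℕ → ℂ}

theorem norm_exp_natCast_mul_I (m : ℕ) (θ : ℝ) : ‖exp (m * θ * I)‖ = 1 := by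
  have := norm_exp_ofReal_mul_I (m * θ)
  push_cast at this
  exact this

theorem continuous_fourierSum (ha : Summable fun m ↦ ‖a m‖) : Continuous (fourierSum a) := by
  refine continuous_tsum (fun m ↦ by fun_prop) ha fun m θ ↦ ?_
  rw [norm_mul, norm_exp_natCast_mul_I, mul_one]

theorem integral_fourierSum_mul_exp (ha : Summable fun m ↦ ‖a m‖) (N : ℕ) :
    ∫ θ in (-Real.pi)..Real.pi, fourierSum a θ * exp (-(N * θ * I)) = 2 * Real.pi * a N := by
  have key : ∀ m : ℕ, ∀ θ : ℝ, a m * exp (m * θ * I) * exp (-(N * θ * I))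
      = a m * exp (((m - N : ℤ) : ℂ) * θ * I) := fun m θ ↦ by
    rw [mul_assoc, ← exp_add]
    push_cast
    ring_nf
  have hnorm (m : ℕ) (θ : ℝ) : ‖a m * exp (((m - N : ℤ) : ℂ) * θ * I)‖ = ‖a m‖ := by
    have := norm_exp_ofReal_mul_I (((m - N : ℤ) : ℝ) * θ)
    push_cast at this
    rw [norm_mul]
    push_cast
    rw [this, mul_one]
  have h := intervalIntegral.hasSum_intervalIntegral_of_summable_norm (a := -Real.pi) (b := Real.pi)
    (f := fun m : ℕ ↦ ⟨fun θ : ℝ ↦ a m * exp (((m - N : ℤ) : ℂ) * θ * I), by fun_prop⟩)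
    (by
      refine Summable.of_nonneg_of_le (fun _ ↦ norm_nonneg _) (fun m ↦ ?_) ha
      rw [ContinuousMap.norm_le _ (norm_nonneg _)]
      intro θ
      exact (hnorm m θ).le)
  have h1 := h.tsum_eq
  simp only [ContinuousMap.coe_mk] at h1
  have h2 : ∀ θ : ℝ, fourierSum a θ * exp (-(N * θ * I))
      = ∑' m : ℕ, a m * exp (((m - N : ℤ) : ℂ) * θ * I) := fun θ ↦ by
    rw [fourierSum, ← tsum_mul_right]
    exact tsum_congr fun m ↦ key m θ
  simp_rw [h2]
  rw [← h1]
  simp_rw [intervalIntegral.integral_const_mul, integral_exp_int_mul_I]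
  rw [tsum_eq_single N fun m hm ↦ by
    rw [if_neg (by omega), mul_zero]]
  simp [mul_comm]

theorem integral_fourierSum_mul_exp_mul_one_sub_cos (ha : Summable fun m ↦ ‖a m‖) (N : ℕ) :
    ∫ θ in (-Real.pi)..Real.pi,
      fourierSum a θ * exp (-((N + 1 : ℕ) * θ * I)) * (1 - Real.cos θ : ℝ)
      = Real.pi * (2 * a (N + 1) - a N - a (N + 2)) := by
  have hIntegrable : ∀ M : ℕ, IntervalIntegrable
      (fun θ : ℝ ↦ fourierSum a θ * exp (-(M * θ * I))) volume (-Real.pi) Real.pi := fun M ↦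
    ((continuous_fourierSum ha).mul (by fun_prop)).intervalIntegrable _ _
  have key : ∀ θ : ℝ, fourierSum a θ * exp (-((N + 1 : ℕ) * θ * I)) * (1 - Real.cos θ : ℝ)
      = fourierSum a θ * exp (-((N + 1 : ℕ) * θ * I))
        - 2⁻¹ * (fourierSum a θ * exp (-(N * θ * I)))
        - 2⁻¹ * (fourierSum a θ * exp (-((N + 2 : ℕ) * θ * I))) := fun θ ↦ by
    have e1 : exp (-(N * θ * I)) = exp (-((N + 1 : ℕ) * θ * I)) * exp (θ * I) := by
      rw [← exp_add]; push_cast; ring_nf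
    have e2 : exp (-((N + 2 : ℕ) * θ * I)) = exp (-((N + 1 : ℕ) * θ * I)) * exp (-θ * I) := by
      rw [← exp_add]; push_cast; ring_nf
    rw [e1, e2]
    push_cast
    rw [Complex.cos]
    ring
  simp_rw [key]
  rw [intervalIntegral.integral_sub ((hIntegrable _).sub ((hIntegrable _).const_mul _))
      ((hIntegrable _).const_mul _),
    intervalIntegral.integral_sub (hIntegrable _) ((hIntegrable _).const_mul _),
    intervalIntegral.integral_const_mul, intervalIntegral.integral_const_mul,
    integral_fourierSum_mul_exp ha, integral_fourierSum_mul_exp ha, integral_fourierSum_mul_exp ha]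
  ring

end Fourier

section ElementaryBounds

theorem sub_pow_three_div_six_le_sin {s : ℝ} (hs : 0 ≤ s) : s - s ^ 3 / 6 ≤ Real.sin s := by
  have hmono : Monotone fun s : ℝ ↦ Real.sin s - s + s ^ 3 / 6 := by
    refine monotone_of_hasDerivAt_nonneg (f' := fun s ↦ Real.cos s - 1 + s ^ 2 / 2)
      (fun s ↦ ?_) fun s ↦ ?_
    · convert! ((Real.hasDerivAt_sin s).sub (hasDerivAt_id s)).add
        ((hasDerivAt_pow 3 s).div_const 6) using 1
      norm_num
      ring
    · have := Real.one_sub_sq_div_two_le_cos (x := s)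
      show (0 : ℝ) ≤ _
      linarith
  have := hmono hs
  simp at this
  linarith

theorem abs_sin_sub_self_le (s : ℝ) : |Real.sin s - s| ≤ |s| ^ 3 / 6 := by
  rcases le_total 0 s with hs | hs
  · have h1 := sub_pow_three_div_six_le_sin hs
    have h2 := Real.sin_le hs
    rw [abs_of_nonneg hs, abs_le]
    constructor <;> linarith
  · have h1 := sub_pow_three_div_six_le_sin (neg_nonneg.2 hs)
    have h2 := Real.sin_le (neg_nonneg.2 hs)
    rw [Real.sin_neg] at h1 h2
    rw [abs_of_nonpos hs, abs_le]
    constructor <;> linarith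

theorem cos_le_one_sub_sq_div_two_add {s : ℝ} (hs : 0 ≤ s) :
    Real.cos s ≤ 1 - s ^ 2 / 2 + s ^ 4 / 24 := by
  have hmono : MonotoneOn (fun s : ℝ ↦ 1 - s ^ 2 / 2 + s ^ 4 / 24 - Real.cos s) (Set.Ici 0) := by
    refine monotoneOn_of_hasDerivWithinAt_nonneg (convex_Ici 0) (by fun_prop)
      (f' := fun s ↦ - s + s ^ 3 / 6 + Real.sin s) (fun s _ ↦ ?_) fun s hs ↦ ?_
    · refine HasDerivAt.hasDerivWithinAt ?_
      convert! ((((hasDerivAt_pow 2 s).div_const 2).const_sub 1).add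
        ((hasDerivAt_pow 4 s).div_const 24)).sub (Real.hasDerivAt_cos s) using 1
      norm_num
      ring
    · rw [interior_Ici] at hs
      have := sub_pow_three_div_six_le_sin (le_of_lt hs)
      linarith
  have := hmono (Set.mem_Ici.2 le_rfl) (Set.mem_Ici.2 hs) hs
  simp at this
  linarith

/-- With `C = 2 cosh y - 2`, this bounds `C` from below by a Taylor polynomial. -/
theorem sq_add_le_two_cosh_sub_two (y : ℝ) :
    y ^ 2 + y ^ 4 / 12 + y ^ 6 / 360 ≤ Real.exp y + Real.exp (-y) - 2 := by
  have h := sum_le_hasSum (Finset.range 4)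
    (fun n _ ↦ div_nonneg (by rw [pow_mul]; positivity) (by positivity)) (Real.hasSum_cosh y)
  rw [Real.cosh_eq] at h
  norm_num [Finset.sum_range_succ, Nat.factorial] at h
  linarith

theorem sum_mul_pow_le {ρ : ℝ} (h0 : 0 ≤ ρ) (h1 : ρ < 1) (N : ℕ) :
    ∑ k ∈ Finset.range N, k * ρ ^ k ≤ ρ / (1 - ρ) ^ 2 := by
  have h2 : 0 < 1 - ρ := sub_pos.2 h1
  have key : ∑ k ∈ Finset.range N, k * ρ ^ k
      = ρ / (1 - ρ) ^ 2 - ρ ^ N * (N / (1 - ρ) + ρ / (1 - ρ) ^ 2) := by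
    induction N with
    | zero => simp
    | succ N ih =>
      rw [Finset.sum_range_succ, ih]
      push_cast
      field_simp
      ring
  have : 0 ≤ ρ ^ N * (N / (1 - ρ) + ρ / (1 - ρ) ^ 2) := by positivity
  linarith

theorem sum_sq_mul_pow_le {ρ : ℝ} (h0 : 0 ≤ ρ) (h1 : ρ < 1) (N : ℕ) :
    ∑ k ∈ Finset.range N, (k : ℝ) ^ 2 * ρ ^ k ≤ ρ * (1 + ρ) / (1 - ρ) ^ 3 := by
  have h2 : 0 < 1 - ρ := sub_pos.2 h1
  have key : ∑ k ∈ Finset.range N, (k : ℝ) ^ 2 * ρ ^ k = ρ * (1 + ρ) / (1 - ρ) ^ 3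
      - ρ ^ N * (N ^ 2 / (1 - ρ) + 2 * N * ρ / (1 - ρ) ^ 2 + ρ * (1 + ρ) / (1 - ρ) ^ 3) := by
    induction N with
    | zero => simp
    | succ N ih =>
      rw [Finset.sum_range_succ, ih]
      push_cast
      field_simp
      ring
  have : 0 ≤ ρ ^ N *
      (N ^ 2 / (1 - ρ) + 2 * N * ρ / (1 - ρ) ^ 2 + ρ * (1 + ρ) / (1 - ρ) ^ 3) := by positivity
  linarith

theorem sum_cube_mul_pow_le {ρ : ℝ} (h0 : 0 ≤ ρ) (h1 : ρ < 1) (N : ℕ) :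
    ∑ k ∈ Finset.range N, (k : ℝ) ^ 3 * ρ ^ k ≤ ρ * (1 + 4 * ρ + ρ ^ 2) / (1 - ρ) ^ 4 := by
  have h2 : 0 < 1 - ρ := sub_pos.2 h1
  have key : ∑ k ∈ Finset.range N, (k : ℝ) ^ 3 * ρ ^ k = ρ * (1 + 4 * ρ + ρ ^ 2) / (1 - ρ) ^ 4
      - ρ ^ N * (N ^ 3 / (1 - ρ) + 3 * N ^ 2 * ρ / (1 - ρ) ^ 2 + 3 * N * ρ * (1 + ρ) / (1 - ρ) ^ 3
        + ρ * (1 + 4 * ρ + ρ ^ 2) / (1 - ρ) ^ 4) := by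
    induction N with
    | zero => simp
    | succ N ih =>
      rw [Finset.sum_range_succ, ih]
      push_cast
      field_simp
      ring
  have : 0 ≤ ρ ^ N * (N ^ 3 / (1 - ρ) + 3 * N ^ 2 * ρ / (1 - ρ) ^ 2
      + 3 * N * ρ * (1 + ρ) / (1 - ρ) ^ 3 + ρ * (1 + 4 * ρ + ρ ^ 2) / (1 - ρ) ^ 4) := by positivity
  linarith

theorem exp_neg_mul_two_cosh_sub_two (y : ℝ) :
    Real.exp (-y) * (Real.exp y + Real.exp (-y) - 2) = (1 - Real.exp (-y)) ^ 2 := by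
  have : Real.exp (-y) * Real.exp y = 1 := by rw [← Real.exp_add]; simp
  linear_combination this

theorem sum_mul_exp_neg_le {y : ℝ} (hy : 0 < y) (N : ℕ) :
    ∑ k ∈ Finset.range N, k * Real.exp (-y) ^ k ≤ 1 / y ^ 2 := by
  have h0 := Real.exp_pos (-y)
  have h1 : Real.exp (-y) < 1 := by simpa using hy
  refine (sum_mul_pow_le h0.le h1 N).trans ?_
  rw [div_le_div_iff₀ (pow_pos (sub_pos.2 h1) 2) (by positivity), ← exp_neg_mul_two_cosh_sub_two,
    one_mul]
  refine mul_le_mul_of_nonneg_left ?_ h0.le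
  have := sq_add_le_two_cosh_sub_two y
  have : 0 ≤ y ^ 4 / 12 + y ^ 6 / 360 := by positivity
  linarith

theorem sum_sq_mul_exp_neg_le {y : ℝ} (hy : 0 < y) (N : ℕ) :
    ∑ k ∈ Finset.range N, (k : ℝ) ^ 2 * Real.exp (-y) ^ k ≤ 2 / y ^ 3 := by
  have h0 := Real.exp_pos (-y)
  have h1 : Real.exp (-y) < 1 := by simpa using hy
  refine (sum_sq_mul_pow_le h0.le h1 N).trans ?_
  have hC := sq_add_le_two_cosh_sub_two y
  have hρ := exp_neg_mul_two_cosh_sub_two y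
  set ρ := Real.exp (-y)
  set C := Real.exp y + ρ - 2
  have h2 : 0 < 1 - ρ := sub_pos.2 h1
  have h3 : 0 < C := lt_of_lt_of_le (by positivity) hC
  rw [div_le_div_iff₀ (by positivity) (by positivity)]
  refine (pow_le_pow_iff_left₀ (by positivity) (by positivity) two_ne_zero).1 ?_
  have e1 : (ρ * (1 + ρ) * y ^ 3) ^ 2 = ρ ^ 3 * ((C + 4) * y ^ 6) := by
    linear_combination -ρ ^ 2 * y ^ 6 * hρ
  have e2 : (2 * (1 - ρ) ^ 3) ^ 2 = ρ ^ 3 * (4 * C ^ 3) := by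
    calc _ = 4 * ((1 - ρ) ^ 2) ^ 3 := by ring
      _ = _ := by rw [← hρ]; ring
  rw [e1, e2]
  refine mul_le_mul_of_nonneg_left ?_ (by positivity)
  obtain ⟨d, hd, hd'⟩ : ∃ d : ℝ, 0 ≤ d ∧ C = y ^ 2 + y ^ 4 / 12 + d :=
    ⟨C - (y ^ 2 + y ^ 4 / 12), by nlinarith [show 0 ≤ y ^ 6 / 360 by positivity], by ring⟩
  rw [hd']
  have : 4 * (y ^ 2 + y ^ 4 / 12 + d) ^ 3 - (y ^ 2 + y ^ 4 / 12 + d + 4) * y ^ 6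
      = y ^ 12 / 432 + d * (y ^ 6 + 12 * y ^ 4 + y ^ 8 / 12)
        + 12 * d ^ 2 * (y ^ 2 + y ^ 4 / 12) + 4 * d ^ 3 := by
    ring
  have : 0 ≤ y ^ 12 / 432 + d * (y ^ 6 + 12 * y ^ 4 + y ^ 8 / 12)
        + 12 * d ^ 2 * (y ^ 2 + y ^ 4 / 12) + 4 * d ^ 3 := by positivity
  linarith

theorem sum_cube_mul_exp_neg_le {y : ℝ} (hy : 0 < y) (N : ℕ) :
    ∑ k ∈ Finset.range N, (k : ℝ) ^ 3 * Real.exp (-y) ^ k ≤ 7 / y ^ 4 := by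
  have h0 := Real.exp_pos (-y)
  have h1 : Real.exp (-y) < 1 := by simpa using hy
  refine (sum_cube_mul_pow_le h0.le h1 N).trans ?_
  have hC := sq_add_le_two_cosh_sub_two y
  have hρ := exp_neg_mul_two_cosh_sub_two y
  set ρ := Real.exp (-y)
  set C := Real.exp y + ρ - 2
  have h2 : 0 < 1 - ρ := sub_pos.2 h1
  rw [div_le_div_iff₀ (by positivity) (by positivity)]
  have e1 : ρ * (1 + 4 * ρ + ρ ^ 2) * y ^ 4 = ρ ^ 2 * ((C + 6) * y ^ 4) := by
    linear_combination -ρ * y ^ 4 * hρ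
  have e2 : 7 * (1 - ρ) ^ 4 = ρ ^ 2 * (7 * C ^ 2) := by
    calc _ = 7 * ((1 - ρ) ^ 2) ^ 2 := by ring
      _ = _ := by rw [← hρ]; ring
  rw [e1, e2]
  refine mul_le_mul_of_nonneg_left ?_ (by positivity)
  obtain ⟨d, hd, hd'⟩ : ∃ d : ℝ, 0 ≤ d ∧ C = y ^ 2 + y ^ 4 / 12 + y ^ 6 / 360 + d :=
    ⟨C - (y ^ 2 + y ^ 4 / 12 + y ^ 6 / 360), by linarith, by ring⟩
  rw [hd']
  have : 7 * (y ^ 2 + y ^ 4 / 12 + y ^ 6 / 360 + d) ^ 2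
      - (y ^ 2 + y ^ 4 / 12 + y ^ 6 / 360 + d + 6) * y ^ 4
      = y ^ 4 + y ^ 6 / 6 + (7 / 80 - 1 / 12) * y ^ 8 + (7 / 2160 - 1 / 360) * y ^ 10
        + 7 / 129600 * y ^ 12
        + d * (14 * y ^ 2 + y ^ 4 / 6 + 7 * y ^ 6 / 180) + 7 * d ^ 2 := by
    ring
  have : 0 ≤ y ^ 4 + y ^ 6 / 6 + (7 / 80 - 1 / 12) * y ^ 8 + (7 / 2160 - 1 / 360) * y ^ 10
        + 7 / 129600 * y ^ 12
        + d * (14 * y ^ 2 + y ^ 4 / 6 + 7 * y ^ 6 / 180) + 7 * d ^ 2 := by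
    have : 0 ≤ (7 / 80 - 1 / 12) * y ^ 8 + (7 / 2160 - 1 / 360) * y ^ 10 := by
      norm_num
      positivity
    have : 0 ≤ y ^ 4 + y ^ 6 / 6 + 7 / 129600 * y ^ 12
        + d * (14 * y ^ 2 + y ^ 4 / 6 + 7 * y ^ 6 / 180) + 7 * d ^ 2 := by positivity
    linarith
  linarith

end ElementaryBounds

section LogFactor

/-- The logarithm of `(1 - r) / (1 - r e^{it})`. -/
noncomputable def logFactor (r t : ℝ) : ℂ :=
  Complex.log (1 - r) - Complex.log (1 - r * Complex.exp (t * Complex.I))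

variable {r : ℝ}

theorem norm_ofReal_mul_exp (h0 : 0 ≤ r) (t : ℝ) : ‖(r : ℂ) * Complex.exp (t * Complex.I)‖ = r := by
  rw [norm_mul, Complex.norm_exp_ofReal_mul_I, mul_one, Complex.norm_of_nonneg h0]

theorem one_sub_ne_zero_of_norm_lt_one {z : ℂ} (hz : ‖z‖ < 1) : 1 - z ≠ 0 := by
  intro h
  rw [← sub_eq_zero.1 h, norm_one] at hz
  exact lt_irrefl _ hz

theorem exp_logFactor (h0 : 0 ≤ r) (h1 : r < 1) (t : ℝ) :
    Complex.exp (logFactor r t) = (1 - r) * (1 - r * Complex.exp (t * Complex.I))⁻¹ := by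
  rw [logFactor, Complex.exp_sub, Complex.exp_log, Complex.exp_log, div_eq_mul_inv]
  · exact one_sub_ne_zero_of_norm_lt_one (by rwa [norm_ofReal_mul_exp h0])
  · exact one_sub_ne_zero_of_norm_lt_one (by rwa [Complex.norm_of_nonneg h0])

theorem hasSum_logFactor (h0 : 0 ≤ r) (h1 : r < 1) (t : ℝ) :
    HasSum (fun j : ℕ ↦ ((r ^ (j + 1) / (j + 1) : ℝ) : ℂ) *
      (Complex.exp (((j + 1) * t : ℝ) * Complex.I) - 1)) (logFactor r t) := by
  have e1 := Complex.hasSum_taylorSeries_neg_log' (z := r * Complex.exp (t * Complex.I))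
    (by rwa [norm_ofReal_mul_exp h0])
  have e2 := Complex.hasSum_taylorSeries_neg_log' (z := r) (by rwa [Complex.norm_of_nonneg h0])
  have e3 := e1.sub e2
  rw [neg_sub_neg] at e3
  refine e3.congr_fun ?_
  intro j
  rw [mul_pow, ← Complex.exp_nat_mul]
  push_cast
  ring_nf

theorem hasSum_re_logFactor (h0 : 0 ≤ r) (h1 : r < 1) (t : ℝ) :
    HasSum (fun j : ℕ ↦ r ^ (j + 1) / (j + 1) * (Real.cos ((j + 1) * t) - 1))
      (logFactor r t).re := by
  refine (Complex.hasSum_re (hasSum_logFactor h0 h1 t)).congr_fun fun j ↦ ?_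
  rw [Complex.re_ofReal_mul, Complex.sub_re, Complex.exp_ofReal_mul_I_re, Complex.one_re]

theorem hasSum_im_logFactor (h0 : 0 ≤ r) (h1 : r < 1) (t : ℝ) :
    HasSum (fun j : ℕ ↦ r ^ (j + 1) / (j + 1) * Real.sin ((j + 1) * t))
      (logFactor r t).im := by
  refine (Complex.hasSum_im (hasSum_logFactor h0 h1 t)).congr_fun fun j ↦ ?_
  rw [Complex.im_ofReal_mul, Complex.sub_im, Complex.exp_ofReal_mul_I_im, Complex.one_im, sub_zero]

theorem summable_pow_mul_geometric_succ (m : ℕ) (h0 : 0 ≤ r) (h1 : r < 1) :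
    Summable fun j : ℕ ↦ ((j : ℝ) + 1) ^ m * r ^ (j + 1) := by
  have := (summable_nat_add_iff 1).2 (summable_pow_mul_geometric_of_norm_lt_one (R := ℝ) m
    (by rwa [Real.norm_of_nonneg h0]))
  exact_mod_cast this

theorem re_logFactor_le (h0 : 0 ≤ r) (h1 : r < 1) (t : ℝ) :
    (logFactor r t).re ≤ -(r * (1 - Real.cos t)) := by
  have h := (hasSum_re_logFactor h0 h1 t).neg
  have := le_hasSum h 0 fun j _ ↦ by
    have := Real.cos_le_one ((j + 1) * t)
    have h2 : 0 ≤ r ^ (j + 1) / (j + 1) := by positivity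
    nlinarith
  norm_num at this
  linarith

theorem le_re_logFactor (h0 : 0 ≤ r) (h1 : r < 1) (t : ℝ) :
    -(t ^ 2 / 2 * ∑' j : ℕ, ((j : ℝ) + 1) * r ^ (j + 1)) ≤ (logFactor r t).re := by
  have hs := summable_pow_mul_geometric_succ 1 h0 h1
  simp only [pow_one] at hs
  refine hasSum_le (fun j ↦ ?_) (hs.hasSum.mul_left (t ^ 2 / 2)).neg (hasSum_re_logFactor h0 h1 t)
  have h2 := Real.one_sub_sq_div_two_le_cos (x := (j + 1) * t)
  have h3 : 0 ≤ r ^ (j + 1) / (j + 1) := by positivity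
  have h4 : t ^ 2 / 2 * (((j : ℝ) + 1) * r ^ (j + 1))
      = r ^ (j + 1) / (j + 1) * (((j + 1) * t) ^ 2 / 2) := by
    field_simp
  rw [h4]
  nlinarith

theorem abs_im_logFactor_sub_le (h0 : 0 ≤ r) (h1 : r < 1) (t : ℝ) :
    |(logFactor r t).im - t * (r / (1 - r))|
      ≤ |t| ^ 3 / 6 * ∑' j : ℕ, ((j : ℝ) + 1) ^ 2 * r ^ (j + 1) := by
  have hg : HasSum (fun j : ℕ ↦ r ^ (j + 1)) (r / (1 - r)) := by
    simpa only [pow_succ', div_eq_mul_inv] using (hasSum_geometric_of_lt_one h0 h1).mul_left r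
  have h := (hasSum_im_logFactor h0 h1 t).sub (hg.mul_left t)
  have hs := (summable_pow_mul_geometric_succ 2 h0 h1).hasSum.mul_left (|t| ^ 3 / 6)
  rw [← h.tsum_eq, ← Real.norm_eq_abs]
  refine tsum_of_norm_bounded hs fun j ↦ ?_
  have h2 := abs_sin_sub_self_le ((j + 1) * t)
  have h3 : 0 ≤ r ^ (j + 1) / (j + 1) := by positivity
  have h4 : r ^ (j + 1) / (j + 1) * Real.sin ((j + 1) * t) - t * r ^ (j + 1)
      = r ^ (j + 1) / (j + 1) * (Real.sin ((j + 1) * t) - (j + 1) * t) := by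
    field_simp
  have h5 : |t| ^ 3 / 6 * (((j : ℝ) + 1) ^ 2 * r ^ (j + 1))
      = r ^ (j + 1) / (j + 1) * (|(j + 1) * t| ^ 3 / 6) := by
    rw [abs_mul, abs_of_nonneg (by positivity : (0 : ℝ) ≤ j + 1)]
    field_simp
  rw [h4, h5, Real.norm_eq_abs, abs_mul, abs_of_nonneg h3]
  exact mul_le_mul_of_nonneg_left h2 h3

end LogFactor

section GeometricCosine

theorem sum_pow_mul_one_sub_cos_ge {r : ℝ} (h0 : 0 ≤ r) (h1 : r < 1) (θ : ℝ) (N : ℕ) :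
    r * (1 + r) * (1 - Real.cos θ) / ((1 - r) * ((1 - r) ^ 2 + 2 * r * (1 - Real.cos θ)))
      - 2 * r ^ N / (1 - r) ≤ ∑ k ∈ Finset.range N, r ^ k * (1 - Real.cos (k * θ)) := by
  set z : ℂ := r * Complex.exp (θ * Complex.I) with hz
  have hzn : ‖z‖ = r := norm_ofReal_mul_exp h0 θ
  have h2 : 0 < 1 - r := sub_pos.2 h1
  have hz1 : 1 - z ≠ 0 := one_sub_ne_zero_of_norm_lt_one (by rwa [hzn])
  have hz2 : 1 - r ≤ ‖1 - z‖ := by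
    have := norm_sub_norm_le (1 : ℂ) z
    rwa [hzn, norm_one] at this
  have e1 : ∑ k ∈ Finset.range N, r ^ k * (1 - Real.cos (k * θ))
      = ∑ k ∈ Finset.range N, r ^ k - (∑ k ∈ Finset.range N, z ^ k).re := by
    rw [Complex.re_sum, ← Finset.sum_sub_distrib]
    refine Finset.sum_congr rfl fun k _ ↦ ?_
    have : z ^ k = ((r ^ k : ℝ) : ℂ) * Complex.exp ((k * θ : ℝ) * Complex.I) := by
      rw [hz, mul_pow, ← Complex.exp_nat_mul]
      push_cast
      ring_nf
    rw [this, Complex.re_ofReal_mul, Complex.exp_ofReal_mul_I_re]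
    ring
  have e2 : ∑ k ∈ Finset.range N, r ^ k = 1 / (1 - r) - r ^ N / (1 - r) := by
    rw [geom_sum_eq h1.ne, ← neg_div_neg_eq]
    ring
  have e3 : ∑ k ∈ Finset.range N, z ^ k = (1 - z)⁻¹ - z ^ N * (1 - z)⁻¹ := by
    rw [geom_sum_eq (fun h ↦ hz1 (by rw [h, sub_self])), ← neg_div_neg_eq]
    ring
  have e4 : |(z ^ N * (1 - z)⁻¹).re| ≤ r ^ N / (1 - r) := by
    refine (Complex.abs_re_le_norm _).trans ?_
    rw [norm_mul, norm_pow, hzn, norm_inv, ← div_eq_mul_inv]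
    gcongr
  have hzre : z.re = r * Real.cos θ := by
    rw [hz, Complex.re_ofReal_mul, Complex.exp_ofReal_mul_I_re]
  have hzim : z.im = r * Real.sin θ := by
    rw [hz, Complex.im_ofReal_mul, Complex.exp_ofReal_mul_I_im]
  have e6 : Complex.normSq (1 - z) = (1 - r) ^ 2 + 2 * r * (1 - Real.cos θ) := by
    rw [Complex.normSq_apply, Complex.sub_re, Complex.sub_im, hzre, hzim, Complex.one_re,
      Complex.one_im]
    linear_combination r ^ 2 * Real.sin_sq_add_cos_sq θ
  have e5 : ((1 - z)⁻¹).re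
      = (1 - r * Real.cos θ) / ((1 - r) ^ 2 + 2 * r * (1 - Real.cos θ)) := by
    rw [Complex.inv_re, e6, Complex.sub_re, hzre, Complex.one_re]
  have hD : 0 < (1 - r) ^ 2 + 2 * r * (1 - Real.cos θ) := by
    rw [← e6]
    exact Complex.normSq_pos.2 hz1
  have e7 : 1 / (1 - r) - (1 - r * Real.cos θ) / ((1 - r) ^ 2 + 2 * r * (1 - Real.cos θ))
      = r * (1 + r) * (1 - Real.cos θ)
        / ((1 - r) * ((1 - r) ^ 2 + 2 * r * (1 - Real.cos θ))) := by
    rw [div_sub_div _ _ h2.ne' hD.ne', div_eq_div_iff (by positivity) (by positivity)]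
    ring
  rw [e1, e2, e3, Complex.sub_re, e5, ← e7]
  have := (abs_le.1 e4).1
  have e8 : 2 * r ^ N / (1 - r) = r ^ N / (1 - r) + r ^ N / (1 - r) := by ring
  linarith

end GeometricCosine

section LogProduct

/-- The logarithm of `∏ k ∈ [2, L + 1], (1 - ρ ^ k) / (1 - (ρ e^{iθ}) ^ k)` with `ρ = e^{-x}`. -/
noncomputable def logProduct (x : ℝ) (L : ℕ) (θ : ℝ) : ℂ :=
  ∑ k ∈ Finset.range L, logFactor (Real.exp (-x) ^ (k + 2)) ((k + 2) * θ)

/-- The derivative at `0` of the imaginary part of `logProduct x L`. -/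
noncomputable def logProductSlope (x : ℝ) (L : ℕ) : ℝ :=
  ∑ k ∈ Finset.range L, ((k : ℝ) + 2) * (Real.exp (-x) ^ (k + 2) / (1 - Real.exp (-x) ^ (k + 2)))

variable {x : ℝ}

theorem exp_neg_pow_lt_one (hx : 0 < x) (k : ℕ) : Real.exp (-x) ^ (k + 1) < 1 :=
  pow_lt_one₀ (Real.exp_pos _).le (by simpa using hx) k.succ_ne_zero

theorem exp_logProduct (hx : 0 < x) (L : ℕ) (θ : ℝ) :
    Complex.exp (logProduct x L θ)
      = ((∏ k ∈ Finset.range L, (1 - Real.exp (-x) ^ (k + 2)) : ℝ) : ℂ) *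
      ∏ k ∈ Finset.range L,
        (1 - ((Real.exp (-x) : ℂ) * Complex.exp (θ * Complex.I)) ^ (k + 2))⁻¹ := by
  rw [logProduct, Complex.exp_sum, Complex.ofReal_prod, ← Finset.prod_mul_distrib]
  refine Finset.prod_congr rfl fun k _ ↦ ?_
  rw [exp_logFactor (by positivity) (exp_neg_pow_lt_one hx (k + 1)), mul_pow, ← Complex.exp_nat_mul]
  push_cast
  ring_nf

theorem hasSum_succ_zeta_two : HasSum (fun j : ℕ ↦ 1 / ((j : ℝ) + 1) ^ 2) (Real.pi ^ 2 / 6) := by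
  have := (hasSum_nat_add_iff' 1).2 hasSum_zeta_two
  simpa using this

theorem sum_pow_mul_tsum_le {c : ℝ} {m : ℕ}
    (hc : ∀ y > 0, ∀ N : ℕ, ∑ k ∈ Finset.range N, (k : ℝ) ^ (m + 1) * Real.exp (-y) ^ k
      ≤ c / y ^ (m + 2)) (hx : 0 < x) (L : ℕ) :
    ∑ k ∈ Finset.range L, ((k : ℝ) + 2) ^ (m + 1) *
        ∑' j : ℕ, ((j : ℝ) + 1) ^ m * (Real.exp (-x) ^ (k + 2)) ^ (j + 1)
      ≤ c / x ^ (m + 2) * (Real.pi ^ 2 / 6) := by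
  have hs (k : ℕ) := ((summable_pow_mul_geometric_succ m (by positivity)
    (exp_neg_pow_lt_one hx (k + 1))).mul_left (((k : ℝ) + 2) ^ (m + 1))).hasSum
  have h1 := hasSum_sum (s := Finset.range L) fun k _ ↦ hs k
  simp_rw [tsum_mul_left] at h1
  refine hasSum_le (fun j ↦ ?_) h1 (hasSum_succ_zeta_two.mul_left (c / x ^ (m + 2)))
  have h2 := hc ((j + 1) * x) (by positivity) (L + 2)
  rw [Finset.sum_range_succ', Finset.sum_range_succ'] at h2
  have h3 : ∑ k ∈ Finset.range L, ((k : ℝ) + 2) ^ (m + 1) * (((j : ℝ) + 1) ^ m *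
      (Real.exp (-x) ^ (k + 2)) ^ (j + 1)) = (j + 1) ^ m * ∑ k ∈ Finset.range L,
        ((k + 1 + 1 : ℕ) : ℝ) ^ (m + 1) * Real.exp (-((j + 1) * x)) ^ (k + 1 + 1) := by
    rw [Finset.mul_sum]
    refine Finset.sum_congr rfl fun k _ ↦ ?_
    have : Real.exp (-((j + 1) * x)) = Real.exp (-x) ^ (j + 1) := by
      rw [← Real.exp_nat_mul]
      push_cast
      ring_nf
    rw [this, ← pow_mul, ← pow_mul]
    push_cast
    ring_nf
  rw [h3]
  have h4 : 0 ≤ ((0 + 1 : ℕ) : ℝ) ^ (m + 1) * Real.exp (-((j + 1) * x)) ^ (0 + 1) := by positivity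
  have h5 : 0 ≤ ((0 : ℕ) : ℝ) ^ (m + 1) * Real.exp (-((j + 1) * x)) ^ 0 := by positivity
  have h6 : c / x ^ (m + 2) * (1 / ((j : ℝ) + 1) ^ 2)
      = (j + 1) ^ m * (c / ((j + 1) * x) ^ (m + 2)) := by
    rw [mul_pow, pow_add ((j : ℝ) + 1) m 2]
    field_simp
  rw [h6]
  refine mul_le_mul_of_nonneg_left (le_trans ?_ h2) (by positivity)
  rw [add_assoc]
  exact le_add_of_nonneg_right (add_nonneg h4 h5)

theorem logProductSlope_le (hx : 0 < x) (L : ℕ) :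
    logProductSlope x L ≤ Real.pi ^ 2 / 6 / x ^ 2 := by
  have h := sum_pow_mul_tsum_le (m := 0) (c := 1)
    (fun y hy N ↦ by simpa using sum_mul_exp_neg_le hy N) hx L
  rw [logProductSlope]
  convert! h using 1
  · refine Finset.sum_congr rfl fun k _ ↦ ?_
    have h1 := exp_neg_pow_lt_one hx (k + 1)
    simp only [zero_add, pow_one, pow_zero, one_mul]
    simp_rw [pow_succ (Real.exp (-x) ^ (k + 2)), tsum_mul_right]
    rw [tsum_geometric_of_lt_one (by positivity) h1, div_eq_inv_mul]
  · ring

theorem le_re_logProduct (hx : 0 < x) (L : ℕ) (θ : ℝ) :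
    -(θ ^ 2 * (Real.pi ^ 2 / 6) / x ^ 3) ≤ (logProduct x L θ).re := by
  have h := sum_pow_mul_tsum_le (m := 1) (c := 2)
    (fun y hy N ↦ sum_sq_mul_exp_neg_le hy N) hx L
  rw [logProduct, Complex.re_sum]
  have h1 := Finset.sum_le_sum fun k (_ : k ∈ Finset.range L) ↦ le_re_logFactor
    (by positivity) (exp_neg_pow_lt_one hx (k + 1)) (((k : ℝ) + 2) * θ)
  refine le_trans ?_ h1
  rw [Finset.sum_neg_distrib, neg_le_neg_iff]
  calc _ = θ ^ 2 / 2 * ∑ k ∈ Finset.range L, ((k : ℝ) + 2) ^ (1 + 1) *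
        ∑' j : ℕ, ((j : ℝ) + 1) ^ 1 * (Real.exp (-x) ^ (k + 2)) ^ (j + 1) := by
        rw [Finset.mul_sum]
        refine Finset.sum_congr rfl fun k _ ↦ ?_
        simp only [pow_one]
        ring
    _ ≤ θ ^ 2 / 2 * (2 / x ^ (1 + 2) * (Real.pi ^ 2 / 6)) := by gcongr
    _ = _ := by ring

theorem abs_im_logProduct_sub_le (hx : 0 < x) (L : ℕ) (θ : ℝ) :
    |(logProduct x L θ).im - θ * logProductSlope x L|
      ≤ |θ| ^ 3 * (7 * Real.pi ^ 2 / 36) / x ^ 4 := by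
  have h := sum_pow_mul_tsum_le (m := 2) (c := 7)
    (fun y hy N ↦ sum_cube_mul_exp_neg_le hy N) hx L
  rw [logProduct, Complex.im_sum, logProductSlope, Finset.mul_sum, ← Finset.sum_sub_distrib]
  refine (Finset.abs_sum_le_sum_abs _ _).trans ?_
  calc _ ≤ ∑ k ∈ Finset.range L, |((k : ℝ) + 2) * θ| ^ 3 / 6 *
        ∑' j : ℕ, ((j : ℝ) + 1) ^ 2 * (Real.exp (-x) ^ (k + 2)) ^ (j + 1) := by
        refine Finset.sum_le_sum fun k _ ↦ ?_
        have := abs_im_logFactor_sub_le (by positivity) (exp_neg_pow_lt_one hx (k + 1))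
          (((k : ℝ) + 2) * θ)
        convert! this using 2
        ring
    _ = |θ| ^ 3 / 6 * ∑ k ∈ Finset.range L, ((k : ℝ) + 2) ^ (2 + 1) *
        ∑' j : ℕ, ((j : ℝ) + 1) ^ 2 * (Real.exp (-x) ^ (k + 2)) ^ (j + 1) := by
        rw [Finset.mul_sum]
        refine Finset.sum_congr rfl fun k _ ↦ ?_
        rw [abs_mul, abs_of_nonneg (by positivity : (0 : ℝ) ≤ k + 2)]
        ring
    _ ≤ |θ| ^ 3 / 6 * (7 / x ^ (2 + 2) * (Real.pi ^ 2 / 6)) := by gcongr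
    _ = _ := by ring

theorem re_logProduct_le (hx : 0 < x) (L : ℕ) (θ : ℝ) :
    (logProduct x L θ).re ≤ Real.exp (-x) * (1 - Real.cos θ)
      + 2 * Real.exp (-x) ^ (L + 2) / (1 - Real.exp (-x))
      - Real.exp (-x) * (1 + Real.exp (-x)) * (1 - Real.cos θ) / ((1 - Real.exp (-x)) *
        ((1 - Real.exp (-x)) ^ 2 + 2 * Real.exp (-x) * (1 - Real.cos θ))) := by
  have h := sum_pow_mul_one_sub_cos_ge (Real.exp_pos (-x)).le (by simpa using hx) θ (L + 2)
  rw [Finset.sum_range_succ', Finset.sum_range_succ'] at h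
  have h1 := Finset.sum_le_sum fun k (_ : k ∈ Finset.range L) ↦ re_logFactor_le
    (by positivity) (exp_neg_pow_lt_one hx (k + 1)) (((k : ℝ) + 2) * θ)
  rw [logProduct, Complex.re_sum]
  rw [Finset.sum_neg_distrib] at h1
  have h2 : ∑ k ∈ Finset.range L, Real.exp (-x) ^ (k + 1 + 1) *
      (1 - Real.cos (((k + 1 + 1 : ℕ) : ℝ) * θ)) = ∑ k ∈ Finset.range L,
        Real.exp (-x) ^ (k + 1 + 1) * (1 - Real.cos (((k : ℝ) + 2) * θ)) := by
    refine Finset.sum_congr rfl fun k _ ↦ ?_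
    push_cast
    ring_nf
  rw [h2] at h
  simp only [zero_add, pow_one, Nat.cast_one, one_mul, pow_zero, Nat.cast_zero, zero_mul,
    Real.cos_zero, sub_self, add_zero] at h
  linarith

end LogProduct

section OscillatoryIntegral

open intervalIntegral

theorem pi_sq_lt : Real.pi ^ 2 < 9.87 := by
  have := Real.pi_lt_d4
  have := Real.pi_pos
  nlinarith

theorem integral_sq_mul_one_sub_pow_mul (a b t : ℝ) (n : ℕ) :
    ∫ τ in (0 : ℝ)..t, τ ^ 2 * (1 - a * τ ^ 2) ^ n * (1 - b * τ ^ 6)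
      = ∑ i ∈ Finset.range (n + 1), (n.choose i) * (-a) ^ i *
        (t ^ (2 * i + 3) / (2 * i + 3) - b * (t ^ (2 * i + 9) / (2 * i + 9))) := by
  have key (τ : ℝ) : τ ^ 2 * (1 - a * τ ^ 2) ^ n * (1 - b * τ ^ 6)
      = ∑ i ∈ Finset.range (n + 1), (n.choose i) * (-a) ^ i *
        (τ ^ (2 * i + 2) - b * τ ^ (2 * i + 8)) := by
    rw [show 1 - a * τ ^ 2 = -a * τ ^ 2 + 1 by ring, add_pow, Finset.mul_sum, Finset.sum_mul]
    refine Finset.sum_congr rfl fun i _ ↦ ?_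
    rw [one_pow, mul_pow, ← pow_mul]
    ring
  simp_rw [key]
  rw [integral_finsetSum fun i _ ↦ Continuous.intervalIntegrable (by fun_prop) _ _]
  refine Finset.sum_congr rfl fun i _ ↦ ?_
  rw [integral_const_mul, integral_sub (Continuous.intervalIntegrable (by fun_prop) _ _)
    (Continuous.intervalIntegrable (by fun_prop) _ _), integral_const_mul, integral_pow,
    integral_pow]
  push_cast
  ring

theorem integral_sq_mul_exp_le {a t₀ t₁ : ℝ} (ha : 0 < a) (h₀ : 0 ≤ t₁) :
    ∫ t in t₀..t₁, t ^ 2 * Real.exp (-a * (t - t₀)) ≤ t₀ ^ 2 / a + 2 * t₀ / a ^ 2 + 2 / a ^ 3 := by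
  have hderiv (t : ℝ) : HasDerivAt
      (fun t ↦ -((t ^ 2 / a + 2 * t / a ^ 2 + 2 / a ^ 3) * Real.exp (-a * (t - t₀))))
      (t ^ 2 * Real.exp (-a * (t - t₀))) t := by
    have h1 : HasDerivAt (fun t : ℝ ↦ t ^ 2 / a + 2 * t / a ^ 2 + 2 / a ^ 3)
        (2 * t / a + 2 / a ^ 2) t := by
      convert! (((hasDerivAt_pow 2 t).div_const a).add
        (((hasDerivAt_id t).const_mul 2).div_const (a ^ 2))).add_const (2 / a ^ 3) using 1
      norm_num
    have h2 : HasDerivAt (fun t : ℝ ↦ Real.exp (-a * (t - t₀)))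
        (Real.exp (-a * (t - t₀)) * (-a)) t := by
      convert! (((hasDerivAt_id t).sub_const t₀).const_mul (-a)).exp using 1
      norm_num
    convert! (h1.mul h2).neg using 1
    field_simp
    ring
  rw [integral_eq_sub_of_hasDerivAt (fun t _ ↦ hderiv t)
    (Continuous.intervalIntegrable (by fun_prop) _ _)]
  have : 0 ≤ (t₁ ^ 2 / a + 2 * t₁ / a ^ 2 + 2 / a ^ 3) * Real.exp (-a * (t₁ - t₀)) := by positivity
  simp only [sub_self, mul_zero, Real.exp_zero, mul_one]
  linarith

/-- On the central arc the integrand is bounded below by a rescaled polynomial. -/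
theorem central_arc_bound {s τ R ψ : ℝ} (hs : 0 < s) (hs' : s ^ 2 ≤ 1 / 50) (h0 : 0 ≤ τ)
    (hτ : τ ≤ 1.7) (hR : -((s ^ 3 * τ) ^ 2 * (Real.pi ^ 2 / 6) / (s ^ 2) ^ 3) ≤ R)
    (hψ : |ψ| ≤ (s ^ 3 * τ) ^ 3 * (7 * Real.pi ^ 2 / 36) / (s ^ 2) ^ 4) :
    0.4999 * s ^ 6 * (τ ^ 2 * (1 - 1645 / 8000 * τ ^ 2) ^ 8 * (1 - 37 / 1000 * τ ^ 6))
      ≤ Real.exp R * Real.cos ψ * (1 - Real.cos (s ^ 3 * τ)) := by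
  have hpi := pi_sq_lt
  have hpi0 := Real.pi_pos
  have hτ2 : τ ^ 2 ≤ 2.89 := by nlinarith
  have hτ6 : τ ^ 6 ≤ 25 := by
    calc τ ^ 6 = (τ ^ 2) ^ 3 := by ring
      _ ≤ 2.89 ^ 3 := by gcongr
      _ ≤ 25 := by norm_num
  have e1 : (s ^ 3 * τ) ^ 2 * (Real.pi ^ 2 / 6) / (s ^ 2) ^ 3 = τ ^ 2 * (Real.pi ^ 2 / 6) := by
    field_simp
  have e2 : (s ^ 3 * τ) ^ 3 * (7 * Real.pi ^ 2 / 36) / (s ^ 2) ^ 4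
      = s * τ ^ 3 * (7 * Real.pi ^ 2 / 36) := by
    field_simp
  rw [e1] at hR
  rw [e2] at hψ
  have hexp : (1 - 1645 / 8000 * τ ^ 2) ^ 8 ≤ Real.exp R := by
    have h1 : 1 - 1645 / 8000 * τ ^ 2 ≤ Real.exp (-(1645 / 8000 * τ ^ 2)) := by
      have := Real.add_one_le_exp (-(1645 / 8000 * τ ^ 2))
      linarith
    calc (1 - 1645 / 8000 * τ ^ 2) ^ 8 ≤ Real.exp (-(1645 / 8000 * τ ^ 2)) ^ 8 := by
          gcongr
          linarith
      _ = Real.exp (8 * -(1645 / 8000 * τ ^ 2)) := by rw [← Real.exp_nat_mul]; norm_num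
      _ ≤ Real.exp R := by
          gcongr
          nlinarith [sq_nonneg τ]
  have hcos : 1 - 37 / 1000 * τ ^ 6 ≤ Real.cos ψ := by
    have h1 := Real.one_sub_sq_div_two_le_cos (x := ψ)
    have h2 : ψ ^ 2 ≤ 37 / 500 * τ ^ 6 := by
      calc ψ ^ 2 = |ψ| ^ 2 := (sq_abs ψ).symm
        _ ≤ (s * τ ^ 3 * 1.92) ^ 2 := by
          gcongr
          refine hψ.trans ?_
          gcongr
          linarith
        _ = s ^ 2 * 3.6864 * τ ^ 6 := by ring
        _ ≤ 1 / 50 * 3.6864 * τ ^ 6 := by gcongr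
        _ ≤ 37 / 500 * τ ^ 6 := by
          gcongr
          norm_num
    linarith
  have hc0 : 0 ≤ 1 - 37 / 1000 * τ ^ 6 := by linarith
  have hvers : 0.4999 * (s ^ 3 * τ) ^ 2 ≤ 1 - Real.cos (s ^ 3 * τ) := by
    have h1 := cos_le_one_sub_sq_div_two_add (show 0 ≤ s ^ 3 * τ by positivity)
    have h2 : (s ^ 3 * τ) ^ 2 ≤ 0.0024 := by
      calc (s ^ 3 * τ) ^ 2 = (s ^ 2) ^ 3 * τ ^ 2 := by ring
        _ ≤ (1 / 50) ^ 3 * 2.89 := by gcongr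
        _ ≤ _ := by norm_num
    nlinarith [sq_nonneg (s ^ 3 * τ)]
  calc _ = (1 - 1645 / 8000 * τ ^ 2) ^ 8 * (1 - 37 / 1000 * τ ^ 6) *
        (0.4999 * (s ^ 3 * τ) ^ 2) := by ring
    _ ≤ _ := mul_le_mul (mul_le_mul hexp hcos hc0 (Real.exp_pos R).le) hvers (by positivity)
      (mul_nonneg (Real.exp_pos R).le (hc0.trans hcos))

/-- On the intermediate arc the exponent decreases at least linearly. -/
theorem middle_arc_bound {s τ u R : ℝ} (hs : 0 < s) (hs' : s ^ 2 ≤ 1 / 50)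
    (hτ : 1.7 ≤ τ) (hτ' : s * τ ≤ 1.5) (hu : 0.9999 * (s ^ 3 * τ) ^ 2 ≤ u)
    (hu' : u ≤ (s ^ 3 * τ) ^ 2)
    (hR : R ≤ 1 / 100 + u / 2 - (1 - 3 / 2 * s ^ 2) * u / (s ^ 2 * ((s ^ 2) ^ 2 + u))) :
    R ≤ -2.6 - 2.8 * (τ - 1.7) := by
  have hu0 : 0 < u := lt_of_lt_of_le (by positivity) hu
  have h1 : u / 2 ≤ 1 / 1000 := by
    have : (s ^ 3 * τ) ^ 2 ≤ (1 / 50) ^ 2 * 1.5 ^ 2 := by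
      calc (s ^ 3 * τ) ^ 2 = (s ^ 2) ^ 2 * (s * τ) ^ 2 := by ring
        _ ≤ (1 / 50) ^ 2 * 1.5 ^ 2 := by gcongr
    norm_num at this ⊢
    linarith
  have h2 : 0.9698 * τ ^ 2 / (1 + s ^ 2 * τ ^ 2)
      ≤ (1 - 3 / 2 * s ^ 2) * u / (s ^ 2 * ((s ^ 2) ^ 2 + u)) := by
    rw [div_le_div_iff₀ (by positivity) (by positivity)]
    have hA : 0.9698 * τ ^ 2 * (s ^ 2 * ((s ^ 2) ^ 2 + u))
        ≤ 0.9698 * (τ ^ 2 * s ^ 6 + τ ^ 2 * s ^ 2 * u) := le_of_eq (by ring)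
    have hB : 0.9698 * (τ ^ 2 * s ^ 6) ≤ 0.97 * u := by nlinarith
    have hC : 0.97 * u * (1 + s ^ 2 * τ ^ 2) ≤ (1 - 3 / 2 * s ^ 2) * u * (1 + s ^ 2 * τ ^ 2) := by
      gcongr
      linarith
    have hD : 0 ≤ τ ^ 2 * s ^ 2 * u := by positivity
    nlinarith
  have h3 : 2.8 * τ - 2.14 ≤ 0.9698 * τ ^ 2 / (1 + s ^ 2 * τ ^ 2) := by
    rw [le_div_iff₀ (by positivity)]
    rcases le_total τ 10.6 with h | h
    · have : s ^ 2 * τ ^ 2 ≤ 1 / 50 * τ ^ 2 := by gcongr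
      have h4 : (2.8 * τ - 2.14) * (1 + s ^ 2 * τ ^ 2)
          ≤ (2.8 * τ - 2.14) * (1 + 1 / 50 * τ ^ 2) := by
        refine mul_le_mul_of_nonneg_left ?_ ?_ <;> linarith
      refine h4.trans ?_
      nlinarith [mul_nonneg (sub_nonneg.2 hτ) (sub_nonneg.2 h),
        mul_nonneg (mul_nonneg (sub_nonneg.2 hτ) (sub_nonneg.2 h)) (sub_nonneg.2 hτ)]
    · have h4 : (s * τ) ^ 2 ≤ 1.5 ^ 2 := by gcongr
      have h5 : (2.8 * τ - 2.14) * (1 + s ^ 2 * τ ^ 2) ≤ (2.8 * τ - 2.14) * 3.25 := by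
        refine mul_le_mul_of_nonneg_left ?_ ?_ <;> nlinarith
      nlinarith
  linarith

/-- On the outer arc the exponent is very negative. -/
theorem outer_arc_bound {x u R : ℝ} (hx : 0 < x) (hx' : x ≤ 1 / 50) (hu : 2.24 * x ^ 2 ≤ u)
    (hu' : u ≤ 4) (hR : R ≤ 1 / 100 + u / 2 - (1 - 3 / 2 * x) * u / (x * (x ^ 2 + u))) :
    R ≤ -(0.62 / x) := by
  have hu0 : 0 < u := lt_of_lt_of_le (by positivity) hu
  have h1 : 0.67 / x ≤ (1 - 3 / 2 * x) * u / (x * (x ^ 2 + u)) := by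
    rw [div_le_div_iff₀ (by positivity) (by positivity)]
    have : 0.67 * (x ^ 2 + u) ≤ (1 - 3 / 2 * x) * u := by nlinarith
    nlinarith
  have h2 : 2.01 ≤ 0.05 / x := by
    rw [le_div_iff₀ hx]
    linarith
  have h3 : 0.67 / x = 0.62 / x + 0.05 / x := by ring
  linarith

theorem exp_neg_div_le {x : ℝ} (hx : 0 < x) (hx' : x ≤ 1 / 50) :
    Real.exp (-(0.62 / x)) ≤ x ^ 5 / 300 := by
  have h1 := Real.pow_div_factorial_le_exp (x := 0.62 / x) (by positivity) 20
  rw [Real.exp_neg, inv_le_comm₀ (Real.exp_pos _) (by positivity)]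
  refine le_trans ?_ h1
  rw [div_pow, div_div, inv_div, div_le_div_iff₀ (by positivity) (by positivity)]
  have : x ^ 15 ≤ (1 / 50) ^ 15 := by gcongr
  calc 300 * (x ^ 20 * (Nat.factorial 20)) = 300 * (Nat.factorial 20) * x ^ 5 * x ^ 15 := by ring
    _ ≤ 300 * (Nat.factorial 20) * x ^ 5 * (1 / 50) ^ 15 := by gcongr
    _ ≤ 0.62 ^ 20 * x ^ 5 := by
      rw [mul_right_comm]
      gcongr
      norm_num [Nat.factorial]

end OscillatoryIntegral

section OscillatoryIntegralPositivity

open intervalIntegral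

variable {s : ℝ} {g R ψ : ℝ → ℝ}

theorem central_integral_ge (hs : 0 < s) (hs' : s ^ 2 ≤ 1 / 50) (hg : Continuous g)
    (hgR : ∀ θ, g θ = Real.exp (R θ) * Real.cos (ψ θ))
    (hR : ∀ θ, 0 ≤ θ → -(θ ^ 2 * (Real.pi ^ 2 / 6) / (s ^ 2) ^ 3) ≤ R θ)
    (hψ : ∀ θ, 0 ≤ θ → |ψ θ| ≤ θ ^ 3 * (7 * Real.pi ^ 2 / 36) / (s ^ 2) ^ 4) :
    0.081 * s ^ 9 ≤ ∫ θ in (0 : ℝ)..s ^ 3 * 1.7, g θ * (1 - Real.cos θ) := by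
  have h1 := mul_integral_comp_mul_left (a := 0) (b := 1.7)
    (f := fun θ ↦ g θ * (1 - Real.cos θ)) (c := s ^ 3)
  rw [mul_zero] at h1
  rw [← h1]
  have h2 : ∫ τ in (0 : ℝ)..1.7, 0.4999 * s ^ 6 *
      (τ ^ 2 * (1 - 1645 / 8000 * τ ^ 2) ^ 8 * (1 - 37 / 1000 * τ ^ 6))
      ≤ ∫ τ in (0 : ℝ)..1.7, g (s ^ 3 * τ) * (1 - Real.cos (s ^ 3 * τ)) := by
    refine integral_mono_on (by norm_num) (Continuous.intervalIntegrable (by fun_prop) _ _)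
      (Continuous.intervalIntegrable (by fun_prop) _ _) fun τ hτ ↦ ?_
    have h0 : 0 ≤ s ^ 3 * τ := mul_nonneg (by positivity) hτ.1
    rw [hgR]
    exact central_arc_bound hs hs' hτ.1 hτ.2 (hR _ h0) (hψ _ h0)
  rw [integral_const_mul, integral_sq_mul_one_sub_pow_mul] at h2
  have h3 : (0.1622 : ℝ)
      ≤ ∑ i ∈ Finset.range (8 + 1), ((Nat.choose 8 i : ℕ) : ℝ) * (-(1645 / 8000)) ^ i *
      (1.7 ^ (2 * i + 3) / (2 * i + 3) - 37 / 1000 * (1.7 ^ (2 * i + 9) / (2 * i + 9))) := by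
    norm_num [Finset.sum_range_succ, Nat.choose]
  calc 0.081 * s ^ 9 ≤ s ^ 3 * (0.4999 * s ^ 6 * 0.1622) := by
        have : 0 < s ^ 9 := by positivity
        linarith
    _ ≤ _ := by
      refine mul_le_mul_of_nonneg_left (le_trans ?_ h2) (by positivity)
      gcongr

theorem abs_mul_one_sub_cos_le {r : ℝ} {θ : ℝ} (hgR : g θ = Real.exp (R θ) * Real.cos (ψ θ))
    (hr : R θ ≤ r) : |g θ * (1 - Real.cos θ)| ≤ Real.exp r * (θ ^ 2 / 2) := by
  have h1 := Real.one_sub_sq_div_two_le_cos (x := θ)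
  have h2 := Real.cos_le_one θ
  rw [hgR, abs_mul, abs_mul, Real.abs_exp, abs_of_nonneg (sub_nonneg.2 h2)]
  have h3 := Real.abs_cos_le_one (ψ θ)
  calc _ ≤ Real.exp r * 1 * (θ ^ 2 / 2) := by
        gcongr
        linarith
    _ = _ := by ring

theorem exp_neg_two_point_six_lt : Real.exp (-2.6) < 0.0745 := by
  have h1 := Real.exp_one_gt_d9
  have h2 : Real.exp (-2.6) ^ 5 = (Real.exp 1 ^ 13)⁻¹ := by
    rw [← Real.exp_nat_mul, ← Real.exp_nat_mul, ← Real.exp_neg]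
    norm_num
  have h3 : (Real.exp 1 ^ 13)⁻¹ < 0.0745 ^ 5 := by
    calc (Real.exp 1 ^ 13)⁻¹ < (2.7182818283 ^ 13)⁻¹ := by gcongr
      _ < _ := by norm_num
  exact lt_of_pow_lt_pow_left₀ 5 (by norm_num) (h2 ▸ h3)

/-- The exponent bound available on every arc, in terms of `x` and `θ`. -/
def HasArcBound (x : ℝ) (R : ℝ → ℝ) : Prop :=
  ∀ θ, R θ ≤ 1 / 100 + 2 * (1 - Real.cos θ) / 2
    - (1 - 3 / 2 * x) * (2 * (1 - Real.cos θ)) / (x * (x ^ 2 + 2 * (1 - Real.cos θ)))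

theorem middle_integral_ge (hs : 0 < s) (hs' : s ^ 2 ≤ 1 / 50) (hg : Continuous g)
    (hgR : ∀ θ, g θ = Real.exp (R θ) * Real.cos (ψ θ)) (hR : HasArcBound (s ^ 2) R)
    (hle : s ^ 3 * 1.7 ≤ 1.5 * s ^ 2) :
    -(0.059 * s ^ 9) ≤ ∫ θ in (s ^ 3 * 1.7)..(1.5 * s ^ 2), g θ * (1 - Real.cos θ) := by
  have hpt : ∀ θ ∈ Set.Icc (s ^ 3 * 1.7) (1.5 * s ^ 2), -(Real.exp (-2.6) / 2 *
      (θ ^ 2 * Real.exp (-(2.8 / s ^ 3) * (θ - s ^ 3 * 1.7)))) ≤ g θ * (1 - Real.cos θ) := by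
    intro θ hθ
    have hθ0 : 0 ≤ θ := le_trans (by positivity) hθ.1
    have e : s ^ 3 * (θ / s ^ 3) = θ := by field_simp
    have hθ2 : θ ^ 2 ≤ 0.001 := by
      calc θ ^ 2 ≤ (1.5 * s ^ 2) ^ 2 := by
            gcongr
            exact hθ.2
        _ ≤ (1.5 * (1 / 50)) ^ 2 := by gcongr
        _ ≤ _ := by norm_num
    have h1 : R θ ≤ -2.6 - 2.8 * (θ / s ^ 3 - 1.7) := by
      refine middle_arc_bound hs hs' ?_ ?_ ?_ ?_ (hR θ)
      · rw [le_div_iff₀ (by positivity), mul_comm]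
        exact hθ.1
      · have e' : s * (θ / s ^ 3) = θ / s ^ 2 := by field_simp
        rw [e', div_le_iff₀ (by positivity)]
        exact hθ.2
      · rw [e]
        have := cos_le_one_sub_sq_div_two_add hθ0
        nlinarith [sq_nonneg θ]
      · rw [e]
        have := Real.one_sub_sq_div_two_le_cos (x := θ)
        linarith
    have h2 := (abs_le.1 (abs_mul_one_sub_cos_le (hgR θ) h1)).1
    have h3 : Real.exp (-2.6 - 2.8 * (θ / s ^ 3 - 1.7))
        = Real.exp (-2.6) * Real.exp (-(2.8 / s ^ 3) * (θ - s ^ 3 * 1.7)) := by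
      rw [← Real.exp_add]
      congr 1
      field_simp
      ring
    rw [h3] at h2
    linarith
  have h4 := integral_mono_on (μ := MeasureTheory.volume) hle
    (Continuous.intervalIntegrable (by fun_prop) _ _)
    (Continuous.intervalIntegrable (by fun_prop) _ _) hpt
  refine le_trans ?_ h4
  rw [integral_neg, integral_const_mul, neg_le_neg_iff]
  have h5 := integral_sq_mul_exp_le (a := 2.8 / s ^ 3) (t₀ := s ^ 3 * 1.7) (t₁ := 1.5 * s ^ 2)
    (by positivity) (by positivity)
  calc _ ≤ 0.0745 / 2 * ((s ^ 3 * 1.7) ^ 2 / (2.8 / s ^ 3)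
        + 2 * (s ^ 3 * 1.7) / (2.8 / s ^ 3) ^ 2 + 2 / (2.8 / s ^ 3) ^ 3) := by
        gcongr
        · exact integral_nonneg hle fun t _ ↦ by positivity
        · exact exp_neg_two_point_six_lt.le
    _ = 0.0745 / 2 * (1.7 ^ 2 / 2.8 + 2 * 1.7 / 2.8 ^ 2 + 2 / 2.8 ^ 3) * s ^ 9 := by
      field_simp
    _ ≤ _ := by
      gcongr
      norm_num

theorem outer_integral_ge (hs : 0 < s) (hs' : s ^ 2 ≤ 1 / 50) (hg : Continuous g)
    (hgR : ∀ θ, g θ = Real.exp (R θ) * Real.cos (ψ θ)) (hR : HasArcBound (s ^ 2) R)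
    (hle : 1.5 * s ^ 2 ≤ Real.pi) :
    -(0.02 * s ^ 9) ≤ ∫ θ in (1.5 * s ^ 2)..Real.pi, g θ * (1 - Real.cos θ) := by
  have hpi := Real.pi_lt_d4
  have hpt : ∀ θ ∈ Set.Icc (1.5 * s ^ 2) Real.pi,
      -((s ^ 2) ^ 5 / 300 * (θ ^ 2 / 2)) ≤ g θ * (1 - Real.cos θ) := by
    intro θ hθ
    have hθ0 : 0 ≤ θ := le_trans (by positivity) hθ.1
    have hcos : Real.cos θ ≤ Real.cos (1.5 * s ^ 2) :=
      Real.cos_le_cos_of_nonneg_of_le_pi (by positivity) hθ.2 hθ.1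
    have h1 : R θ ≤ -(0.62 / s ^ 2) := by
      refine outer_arc_bound (by positivity) hs' ?_ ?_ (hR θ)
      · have := cos_le_one_sub_sq_div_two_add (s := 1.5 * s ^ 2) (by positivity)
        have h6 : (1.5 * s ^ 2) ^ 4 ≤ 0.0021 * (s ^ 2) ^ 2 := by
          calc (1.5 * s ^ 2) ^ 4 = (1.5 ^ 4 * (s ^ 2) ^ 2) * (s ^ 2) ^ 2 := by ring
            _ ≤ (1.5 ^ 4 * (1 / 50) ^ 2) * (s ^ 2) ^ 2 := by gcongr
            _ ≤ _ := by
              gcongr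
              norm_num
        nlinarith
      · linarith [Real.neg_one_le_cos θ]
    have h2 := (abs_le.1 (abs_mul_one_sub_cos_le (hgR θ) h1)).1
    have h3 := mul_le_mul_of_nonneg_right (exp_neg_div_le (x := s ^ 2) (by positivity) hs')
      (show 0 ≤ θ ^ 2 / 2 by positivity)
    linarith
  have h4 := integral_mono_on (μ := MeasureTheory.volume) hle
    (Continuous.intervalIntegrable (by fun_prop) _ _)
    (Continuous.intervalIntegrable (by fun_prop) _ _) hpt
  refine le_trans ?_ h4
  rw [integral_neg, integral_const_mul, integral_div, integral_pow, neg_le_neg_iff]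
  have hs1 : s ≤ 1 := by nlinarith
  calc (s ^ 2) ^ 5 / 300 * ((Real.pi ^ (2 + 1) - (1.5 * s ^ 2) ^ (2 + 1)) / ((2 : ℕ) + 1) / 2)
      ≤ (s ^ 2) ^ 5 / 300 * ((3.1416 ^ 3 - 0) / ((2 : ℕ) + 1) / 2) := by
        have : 0 ≤ (1.5 * s ^ 2) ^ (2 + 1) := by positivity
        gcongr
    _ ≤ 0.02 * (s ^ 9 * s) := by
      have : 0 ≤ s ^ 10 := by positivity
      norm_num
      linarith
    _ ≤ 0.02 * (s ^ 9 * 1) := by gcongr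
    _ = _ := by ring

theorem integral_mul_one_sub_cos_pos (hs : 0 < s) (hs' : s ^ 2 ≤ 1 / 50) (hg : Continuous g)
    (hgR : ∀ θ, g θ = Real.exp (R θ) * Real.cos (ψ θ))
    (hR : ∀ θ, 0 ≤ θ → -(θ ^ 2 * (Real.pi ^ 2 / 6) / (s ^ 2) ^ 3) ≤ R θ)
    (hψ : ∀ θ, 0 ≤ θ → |ψ θ| ≤ θ ^ 3 * (7 * Real.pi ^ 2 / 36) / (s ^ 2) ^ 4)
    (hR' : HasArcBound (s ^ 2) R) :
    0 < ∫ θ in (0 : ℝ)..Real.pi, g θ * (1 - Real.cos θ) := by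
  have hs1 : s ≤ 0.2 := by nlinarith
  have hle : s ^ 3 * 1.7 ≤ 1.5 * s ^ 2 := by nlinarith [sq_nonneg s]
  have hle' : 1.5 * s ^ 2 ≤ Real.pi := by linarith [Real.pi_gt_three]
  have hIntegrable (a b : ℝ) : IntervalIntegrable (fun θ ↦ g θ * (1 - Real.cos θ))
      MeasureTheory.volume a b := Continuous.intervalIntegrable (by fun_prop) _ _
  rw [← integral_add_adjacent_intervals (hIntegrable 0 (1.5 * s ^ 2)) (hIntegrable _ _),
    ← integral_add_adjacent_intervals (hIntegrable 0 (s ^ 3 * 1.7)) (hIntegrable _ _)]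
  have h1 := central_integral_ge hs hs' hg hgR hR hψ
  have h2 := middle_integral_ge hs hs' hg hgR hR' hle
  have h3 := outer_integral_ge hs hs' hg hgR hR' hle'
  have : 0 < s ^ 9 := by positivity
  linarith

end OscillatoryIntegralPositivity

section AnalyticRange

open Filter

theorem partitionFn_le_succ (n : ℕ) : partitionFn n ≤ partitionFn (n + 1) := by
  refine Fintype.card_le_of_injective
    (fun P : Nat.Partition n ↦ (⟨1 ::ₘ P.parts, fun {i} hi ↦ ?_, ?_⟩ : Nat.Partition (n + 1))) ?_
  · rcases Multiset.mem_cons.1 hi with rfl | hi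
    · exact one_pos
    · exact P.parts_pos hi
  · rw [Multiset.sum_cons, P.parts_sum, add_comm]
  · intro P Q h
    have := congrArg Nat.Partition.parts h
    exact Nat.Partition.ext ((Multiset.cons_inj_right 1).1 this)

theorem hasArcBound_logProduct {x : ℝ} {L : ℕ} (hx : 0 < x)
    (hL : 2 * Real.exp (-x) ^ (L + 2) / (1 - Real.exp (-x)) ≤ 1 / 100) :
    HasArcBound x fun θ ↦ (logProduct x L θ).re := by
  intro θ
  have h := re_logProduct_le hx L θ
  have hc := Real.cos_le_one θ
  set ρ := Real.exp (-x)
  set c := 1 - Real.cos θ with hcdef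
  have hc0 : 0 ≤ c := sub_nonneg.2 hc
  have h0 : 0 < ρ := Real.exp_pos _
  have h1 : ρ < 1 := by simpa [ρ] using hx
  have h1' : 0 < 1 - ρ := sub_pos.2 h1
  have h2 : 1 - x ≤ ρ := Real.one_sub_le_exp_neg x
  have h3 : (1 - 3 / 2 * x) * (2 * c) / (x * (x ^ 2 + 2 * c))
      ≤ ρ * (1 + ρ) * c / ((1 - ρ) * ((1 - ρ) ^ 2 + 2 * ρ * c)) := by
    have h4 : (1 - 3 / 2 * x) * 2 ≤ ρ * (1 + ρ) := by nlinarith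
    have h5 : 1 - ρ ≤ x := by linarith
    rcases hc0.eq_or_lt with h6 | h6
    · simp [← h6]
    · calc (1 - 3 / 2 * x) * (2 * c) / (x * (x ^ 2 + 2 * c))
          = (1 - 3 / 2 * x) * 2 * c / (x * (x ^ 2 + 2 * 1 * c)) := by ring
        _ ≤ _ := by gcongr
  have h7 : ρ * c ≤ 1 * c := by gcongr
  show (logProduct x L θ).re ≤ _
  linarith

theorem exists_logProductSlope_eq {n L : ℕ} (hn : 4112 ≤ n) (hL : 1 ≤ L) :
    ∃ x, 1 / (2 * n : ℝ) ≤ x ∧ x ≤ 1 / 50 ∧ logProductSlope x L = n + 1 := by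
  have hn' : (4112 : ℝ) ≤ n := by exact_mod_cast hn
  have hle : 1 / (2 * n : ℝ) ≤ 1 / 50 := by gcongr; linarith
  have hcont : ContinuousOn (fun x ↦ logProductSlope x L) (Set.Icc (1 / (2 * n : ℝ)) (1 / 50)) := by
    unfold logProductSlope
    refine continuousOn_finsetSum _ fun k _ ↦ ContinuousOn.mul continuousOn_const
      (ContinuousOn.div (by fun_prop) (by fun_prop) fun x hx ↦ ?_)
    have hx0 : 0 < x := lt_of_lt_of_le (by positivity) hx.1
    exact (sub_pos.2 (exp_neg_pow_lt_one hx0 (k + 1))).ne'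
  have h1 : logProductSlope (1 / 50) L ≤ n + 1 := by
    refine (logProductSlope_le (by norm_num) L).trans ?_
    have := pi_sq_lt
    norm_num at this ⊢
    linarith
  have h2 : (n : ℝ) + 1 ≤ logProductSlope (1 / (2 * n)) L := by
    have hx0 : 0 < 1 / (2 * n : ℝ) := by positivity
    set ρ := Real.exp (-(1 / (2 * n : ℝ))) with hρ
    have hterm : ∀ k ∈ Finset.range L, 0 ≤ ((k : ℝ) + 2) * (ρ ^ (k + 2) / (1 - ρ ^ (k + 2))) := by
      intro k _
      have := exp_neg_pow_lt_one hx0 (k + 1)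
      exact mul_nonneg (by positivity) (div_nonneg (by positivity) (sub_pos.2 this).le)
    have h3 := Finset.single_le_sum hterm (Finset.mem_range.2 hL)
    refine le_trans ?_ h3
    have h4 : ρ ^ 2 < 1 := exp_neg_pow_lt_one hx0 1
    have h5 : 1 - 1 / (n : ℝ) ≤ ρ ^ 2 := by
      have h6 := Real.one_sub_le_exp_neg (1 / (n : ℝ))
      refine h6.trans (le_of_eq ?_)
      rw [hρ, ← Real.exp_nat_mul]
      congr 1
      push_cast
      field_simp
    have h6 : (n : ℝ) * (1 / n) = 1 := by field_simp
    have h7 : ((n : ℝ) + 1) / 2 ≤ ρ ^ 2 / (1 - ρ ^ 2) := by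
      rw [le_div_iff₀ (sub_pos.2 h4)]
      nlinarith
    simp only [Nat.cast_zero, zero_add]
    linarith
  obtain ⟨x, hx, hx'⟩ := intermediate_value_Icc' hle hcont ⟨h1, h2⟩
  exact ⟨x, hx.1, hx.2, hx'⟩

theorem coeff_partsSeries_turan {x : ℝ} {n L : ℕ} (hx : 0 < x) (hx' : x ≤ 1 / 50)
    (hslope : logProductSlope x L = n + 1)
    (hL : 2 * Real.exp (-x) ^ (L + 2) / (1 - Real.exp (-x)) ≤ 1 / 100) :
    0 < (2 * (PowerSeries.coeff (n + 1) (partsSeries L) * (Real.exp (-x) : ℂ) ^ (n + 1))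
      - PowerSeries.coeff n (partsSeries L) * (Real.exp (-x) : ℂ) ^ n
      - PowerSeries.coeff (n + 2) (partsSeries L) * (Real.exp (-x) : ℂ) ^ (n + 2)).re := by
  set ρ := Real.exp (-x) with hρ
  have h0 : 0 < ρ := Real.exp_pos _
  have h1 : ρ < 1 := by simpa [ρ] using hx
  set a : ℕ → ℂ := fun m ↦ PowerSeries.coeff m (partsSeries L) * (ρ : ℂ) ^ m
  have ha : Summable fun m ↦ ‖a m‖ :=
    (absHasSumAt_partsSeries L (z := ρ) (by rwa [Complex.norm_of_nonneg h0.le])).1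
  have hF (θ : ℝ) : fourierSum a θ = ∏ k ∈ Finset.range L,
      (1 - ((ρ : ℂ) * Complex.exp (θ * Complex.I)) ^ (k + 2))⁻¹ := by
    rw [← (absHasSumAt_partsSeries L (z := ρ * Complex.exp (θ * Complex.I))
      (by rwa [norm_ofReal_mul_exp h0.le])).2, fourierSum]
    refine tsum_congr fun m ↦ ?_
    rw [mul_pow, ← Complex.exp_nat_mul, mul_assoc, mul_assoc]
  set c : ℝ := ∏ k ∈ Finset.range L, (1 - ρ ^ (k + 2)) with hc
  have hc0 : 0 < c := Finset.prod_pos fun k _ ↦ sub_pos.2 (exp_neg_pow_lt_one hx (k + 1))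
  set G : ℝ → ℂ := fun θ ↦ fourierSum a θ * Complex.exp (-((n + 1 : ℕ) * θ * Complex.I))
  have hGcont : Continuous G := (continuous_fourierSum ha).mul (by fun_prop)
  have hG (θ : ℝ) : c * G θ
      = Complex.exp (logProduct x L θ - ((θ * logProductSlope x L : ℝ) : ℂ) * Complex.I) := by
    rw [sub_eq_add_neg, Complex.exp_add, exp_logProduct hx, ← hρ, ← hF, hslope, ← hc]
    simp only [G, ← mul_assoc]
    congr 2
    push_cast
    ring
  set g : ℝ → ℝ := fun θ ↦ c * (G θ).re
  have hgcont : Continuous g := by fun_prop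
  have hg (θ : ℝ) : g θ = Real.exp (logProduct x L θ).re *
      Real.cos ((logProduct x L θ).im - θ * logProductSlope x L) := by
    have := congrArg Complex.re (hG θ)
    rw [Complex.re_ofReal_mul, Complex.exp_re] at this
    simpa using this
  have hs : 0 < √x := Real.sqrt_pos.2 hx
  have hsx : √x ^ 2 = x := Real.sq_sqrt hx.le
  have hpos : 0 < ∫ θ in (0 : ℝ)..Real.pi, g θ * (1 - Real.cos θ) := by
    refine integral_mul_one_sub_cos_pos hs (by rwa [hsx]) hgcont hg (fun θ _ ↦ ?_)
      (fun θ hθ ↦ ?_) (by rw [hsx]; exact hasArcBound_logProduct hx hL)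
    · rw [hsx]
      exact le_re_logProduct hx L θ
    · rw [hsx]
      have := abs_im_logProduct_sub_le hx L θ
      rwa [abs_of_nonneg hθ] at this
  have hneg : 0 < ∫ θ in (0 : ℝ)..Real.pi, g (-θ) * (1 - Real.cos θ) := by
    refine integral_mul_one_sub_cos_pos hs (by rwa [hsx]) (g := fun θ ↦ g (-θ)) (by fun_prop)
      (fun θ ↦ hg (-θ)) (fun θ _ ↦ ?_) (fun θ hθ ↦ ?_) ?_
    · rw [hsx, ← neg_sq θ]
      exact le_re_logProduct hx L (-θ)
    · rw [hsx]
      have := abs_im_logProduct_sub_le hx L (-θ)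
      rwa [abs_neg, abs_of_nonneg hθ] at this
    · rw [hsx]
      intro θ
      have := hasArcBound_logProduct hx hL (-θ)
      rwa [Real.cos_neg] at this
  have hneg' : 0 < ∫ θ in (-Real.pi)..0, g θ * (1 - Real.cos θ) := by
    have := intervalIntegral.integral_comp_neg (a := 0) (b := Real.pi)
      fun θ ↦ g θ * (1 - Real.cos θ)
    simp only [Real.cos_neg, neg_zero] at this
    rwa [← this]
  have hall : 0 < ∫ θ in (-Real.pi)..Real.pi, g θ * (1 - Real.cos θ) := by
    rw [← intervalIntegral.integral_add_adjacent_intervals (b := 0)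
      (Continuous.intervalIntegrable (by fun_prop) _ _)
      (Continuous.intervalIntegrable (by fun_prop) _ _)]
    exact add_pos hneg' hpos
  have hkey := integral_fourierSum_mul_exp_mul_one_sub_cos ha n
  have hre := Complex.reCLM.intervalIntegral_comp_comm (μ := MeasureTheory.volume)
    (a := -Real.pi) (b := Real.pi) (f := fun θ : ℝ ↦ G θ * ((1 - Real.cos θ : ℝ) : ℂ))
    (Continuous.intervalIntegrable (by fun_prop) _ _)
  have hgG : ∀ θ : ℝ, g θ * (1 - Real.cos θ)
      = c * Complex.reCLM (G θ * ((1 - Real.cos θ : ℝ) : ℂ)) := fun θ ↦ by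
    rw [Complex.reCLM_apply, Complex.re_mul_ofReal, ← mul_assoc]
  simp_rw [hgG] at hall
  rw [intervalIntegral.integral_const_mul, hre, hkey, Complex.reCLM_apply,
    Complex.re_ofReal_mul] at hall
  exact pos_of_mul_pos_right (pos_of_mul_pos_right hall hc0.le) Real.pi_pos.le

/-- Strict log-concavity of the differences `p(m) - p(m - 1)` in the range of the saddle point
method. -/
theorem partitionFn_turan_of_large {n : ℕ} (hn : 4112 ≤ n + 1) :
    ((partitionFn (n + 1) : ℝ) - partitionFn n) * (partitionFn (n + 3) - partitionFn (n + 2))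
      < ((partitionFn (n + 2) : ℝ) - partitionFn (n + 1)) ^ 2 := by
  set q := Real.exp (-(1 / (2 * (n + 1 : ℕ) : ℝ)))
  have hq0 : 0 < q := Real.exp_pos _
  have hq1 : q < 1 := by
    simp only [q, Real.exp_lt_one_iff, neg_lt_zero]
    positivity
  have hlim : ∀ᶠ L : ℕ in atTop, q ^ L < (1 - q) / 200 :=
    (tendsto_pow_atTop_nhds_zero_of_lt_one hq0.le hq1).eventually_lt_const
      (by linarith)
  obtain ⟨L, hagree, hqL, hL1⟩ :=
    ((eventually_coeff_eq_coeff_one_sub_X_mul_partitionSeries ℂ (n + 3)).and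
      (hlim.and (eventually_ge_atTop 1))).exists
  obtain ⟨x, hx1, hx2, hslope⟩ := exists_logProductSlope_eq hn hL1
  have hx0 : 0 < x := lt_of_lt_of_le (by positivity) hx1
  have hρq : Real.exp (-x) ≤ q := Real.exp_le_exp.2 (neg_le_neg hx1)
  have hL : 2 * Real.exp (-x) ^ (L + 2) / (1 - Real.exp (-x)) ≤ 1 / 100 := by
    have h1 : 0 < 1 - q := sub_pos.2 hq1
    calc 2 * Real.exp (-x) ^ (L + 2) / (1 - Real.exp (-x)) ≤ 2 * q ^ (L + 2) / (1 - q) := by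
          gcongr
      _ ≤ 2 * q ^ L / (1 - q) := by
          refine div_le_div_of_nonneg_right (mul_le_mul_of_nonneg_left ?_ zero_le_two) h1.le
          exact pow_le_pow_of_le_one hq0.le hq1.le (by omega)
      _ ≤ 1 / 100 := by
          rw [div_le_iff₀ h1]
          linarith
  have h := coeff_partsSeries_turan hx0 hx2 hslope hL
  have hco := hagree _ (partsSeries_mul_prod L)
  rw [hco _ (by omega), hco _ (by omega), hco _ (by omega),
    coeff_succ_one_sub_X_mul_partitionSeries, coeff_succ_one_sub_X_mul_partitionSeries,
    coeff_succ_one_sub_X_mul_partitionSeries] at h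
  have h0 : (partitionFn n : ℝ) ≤ partitionFn (n + 1) := by exact_mod_cast partitionFn_le_succ n
  have h2 : (partitionFn (n + 2) : ℝ) ≤ partitionFn (n + 3) := by
    exact_mod_cast partitionFn_le_succ (n + 2)
  set d₀ : ℝ := partitionFn (n + 1) - partitionFn n with hd₀
  set d₁ : ℝ := partitionFn (n + 2) - partitionFn (n + 1) with hd₁
  set d₂ : ℝ := partitionFn (n + 3) - partitionFn (n + 2) with hd₂
  set ρ := Real.exp (-x)
  have hρ : 0 < ρ := Real.exp_pos _
  have h3 : 0 < 2 * (d₁ * ρ ^ (n + 1 + 1)) - d₀ * ρ ^ (n + 1) - d₂ * ρ ^ (n + 1 + 2) := by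
    refine h.trans_eq ((congrArg Complex.re ?_).trans (Complex.ofReal_re _))
    simp only [hd₀, hd₁, hd₂, Complex.ofReal_sub, Complex.ofReal_mul, Complex.ofReal_pow,
      Complex.ofReal_natCast, Complex.ofReal_ofNat]
  have h4 : 0 < 2 * (d₁ * ρ) - d₀ - d₂ * ρ ^ 2 := by
    have : ρ ^ (n + 1) * (2 * (d₁ * ρ) - d₀ - d₂ * ρ ^ 2)
        = 2 * (d₁ * ρ ^ (n + 1 + 1)) - d₀ * ρ ^ (n + 1) - d₂ * ρ ^ (n + 1 + 2) := by ring
    rw [← this] at h3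
    exact pos_of_mul_pos_right h3 (by positivity)
  have h5 : 0 ≤ d₀ := sub_nonneg.2 h0
  have h6 : 0 ≤ d₂ * ρ ^ 2 := mul_nonneg (sub_nonneg.2 h2) (by positivity)
  have h7 : 4 * ρ ^ 2 * (d₀ * d₂) < 4 * ρ ^ 2 * d₁ ^ 2 := by
    calc 4 * ρ ^ 2 * (d₀ * d₂) = 4 * d₀ * (d₂ * ρ ^ 2) := by ring
      _ ≤ (d₀ + d₂ * ρ ^ 2) ^ 2 := four_mul_le_sq_add _ _
      _ < (2 * (d₁ * ρ)) ^ 2 := pow_lt_pow_left₀ (by linarith) (add_nonneg h5 h6) two_ne_zero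
      _ = 4 * ρ ^ 2 * d₁ ^ 2 := by ring
  exact lt_of_mul_lt_mul_left h7 (by positivity)

end AnalyticRange

section PentagonalTruncation

open Polynomial

theorem abs_coeff_pentagonalSeries_le_one (n : ℕ) :
    |(PowerSeries.pentagonalSeries ℤ).coeff n| ≤ 1 := by
  by_cases h : n ∈ Set.range pentagonal
  · obtain ⟨k, rfl⟩ := h
    rw [PowerSeries.coeff_pentagonalSeries_pentagonal]
    rcases Int.even_or_odd k with h | h
    · simp [Int.negOnePow_even k h]
    · simp [Int.negOnePow_odd k h]
  · simp [PowerSeries.coeff_pentagonalSeries_eq_zero ℤ h]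

/-- The part of the pentagonal number series with indices in `[-2 J, 2 J]`. -/
noncomputable def pentagonalPoly (J : ℕ) : ℤ[X] :=
  ∑ k ∈ Finset.Icc (-(2 * J : ℤ)) (2 * J), C (Int.negOnePow k : ℤ) * X ^ pentagonal k

theorem coeff_pentagonalPoly {J n : ℕ} (hn : n < (2 * J + 1) * (3 * J + 1)) :
    (pentagonalPoly J).coeff n = (PowerSeries.pentagonalSeries ℤ).coeff n := by
  simp only [pentagonalPoly, finsetSum_coeff, coeff_C_mul, coeff_X_pow]
  by_cases h : n ∈ Set.range pentagonal
  · obtain ⟨j, rfl⟩ := h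
    have hj : j ∈ Finset.Icc (-(2 * J : ℤ)) (2 * J) := by
      have h1 := two_mul_natCast_pentagonal j
      have h2 : (pentagonal j : ℤ) < (2 * J + 1) * (3 * J + 1) := by exact_mod_cast hn
      rw [Finset.mem_Icc]
      constructor
      all_goals
        by_contra! h3
        nlinarith
    rw [Finset.sum_eq_single_of_mem j hj fun k _ hk ↦ by
      simp [pentagonal_injective.ne_iff.2 hk.symm]]
    rw [if_pos rfl, mul_one, PowerSeries.coeff_pentagonalSeries_pentagonal, Int.cast_id]
  · rw [PowerSeries.coeff_pentagonalSeries_eq_zero ℤ h]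
    refine Finset.sum_eq_zero fun k _ ↦ ?_
    simp [show n ≠ pentagonal k from fun hk ↦ h ⟨k, hk.symm⟩]

/-- The terms of even index of the truncated pentagonal number series, evaluated at `b`. -/
def pentagonalEven (b : ℕ) : ℕ → ℕ
  | 0 => 1
  | j + 1 => pentagonalEven b j + (b ^ ((j + 1) * (6 * j + 5)) + b ^ ((j + 1) * (6 * j + 7)))

/-- The terms of odd index of the truncated pentagonal number series, evaluated at `b`. -/
def pentagonalOdd (b : ℕ) : ℕ → ℕ
  | 0 => 0
  | j + 1 => pentagonalOdd b j +
      (b ^ ((2 * j + 1) * (3 * j + 1)) + b ^ ((2 * j + 1) * (3 * j + 2)))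

theorem eval_pentagonalPoly (b J : ℕ) :
    (pentagonalPoly J).eval (b : ℤ) = pentagonalEven b J - pentagonalOdd b J := by
  induction J with
  | zero => simp [pentagonalPoly, pentagonalEven, pentagonalOdd, pentagonal]
  | succ J ih =>
    have hIcc : Finset.Icc (-(2 * (J + 1 : ℕ) : ℤ)) (2 * (J + 1 : ℕ))
        = insert (2 * J + 1 : ℤ) (insert (-(2 * J + 1) : ℤ) (insert (2 * J + 2 : ℤ)
          (insert (-(2 * J + 2) : ℤ) (Finset.Icc (-(2 * J : ℤ)) (2 * J))))) := by
      ext k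
      simp only [Finset.mem_insert, Finset.mem_Icc]
      omega
    have hodd : Odd (2 * J + 1 : ℤ) := ⟨J, rfl⟩
    have heven : Even (2 * J + 2 : ℤ) := ⟨J + 1, by ring⟩
    have h1 : pentagonal (2 * J + 1) = (2 * J + 1) * (3 * J + 1) := by
      zify
      linarith [two_mul_natCast_pentagonal (2 * J + 1)]
    have h2 : pentagonal (-(2 * J + 1)) = (2 * J + 1) * (3 * J + 2) := by
      zify
      linarith [two_mul_natCast_pentagonal_neg (2 * J + 1)]
    have h3 : pentagonal (2 * J + 2) = (J + 1) * (6 * J + 5) := by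
      zify
      linarith [two_mul_natCast_pentagonal (2 * J + 2)]
    have h4 : pentagonal (-(2 * J + 2)) = (J + 1) * (6 * J + 7) := by
      zify
      linarith [two_mul_natCast_pentagonal_neg (2 * J + 2)]
    rw [pentagonalPoly, hIcc, Finset.sum_insert, Finset.sum_insert, Finset.sum_insert,
      Finset.sum_insert, h1, h2, h3, h4, Int.negOnePow_odd _ hodd, Int.negOnePow_odd _ hodd.neg,
      Int.negOnePow_even _ heven, Int.negOnePow_even _ heven.neg, ← pentagonalPoly]
    · simp only [eval_add, eval_mul, eval_C, eval_pow, eval_X, ih, pentagonalEven, pentagonalOdd]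
      push_cast
      ring
    all_goals
      simp only [Finset.mem_insert, Finset.mem_Icc]
      omega

theorem pow_dvd_sum_mul_sub_one {b m J : ℕ} (hm : m ≤ (2 * J + 1) * (3 * J + 1)) :
    (b : ℤ) ^ m ∣ (∑ i ∈ Finset.range m, (partitionFn i : ℤ) * b ^ i)
      * (pentagonalEven b J - pentagonalOdd b J) - 1 := by
  have h1 : (X : ℤ[X]) ^ m ∣
      PowerSeries.trunc m (partitionSeries ℤ) * pentagonalPoly J - 1 := by
    rw [X_pow_dvd_iff]
    intro d hd
    have h2 := congrArg (PowerSeries.coeff d) (partitionSeries_mul_pentagonalSeries ℤ)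
    rw [PowerSeries.coeff_mul, PowerSeries.coeff_one] at h2
    rw [coeff_sub, coeff_mul, coeff_one, ← h2, sub_eq_zero]
    refine Finset.sum_congr rfl fun ij hij ↦ ?_
    have := Finset.HasAntidiagonal.mem_antidiagonal.1 hij
    rw [PowerSeries.coeff_trunc, if_pos (by omega), coeff_pentagonalPoly (by omega)]
  have h2 := eval_dvd (x := (b : ℤ)) h1
  rw [eval_sub, eval_mul, eval_pentagonalPoly, eval_one, eval_pow, eval_X, eval,
    PowerSeries.eval₂_trunc_eq_sum_range] at h2
  simpa [partitionSeries] using h2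

theorem partitionFn_le_sum_range {n : ℕ} (hn : n ≠ 0) :
    partitionFn n ≤ ∑ i ∈ Finset.range n, partitionFn i := by
  have h1 := congrArg (PowerSeries.coeff n) (partitionSeries_mul_pentagonalSeries ℤ)
  rw [PowerSeries.coeff_mul, PowerSeries.coeff_one, if_neg hn,
    Finset.Nat.sum_antidiagonal_eq_sum_range_succ fun i j ↦
      (partitionSeries ℤ).coeff i * (PowerSeries.pentagonalSeries ℤ).coeff j,
    Finset.sum_range_succ, Nat.sub_self] at h1
  have h0 : (PowerSeries.pentagonalSeries ℤ).coeff 0 = 1 := by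
    simpa [pentagonal] using PowerSeries.coeff_pentagonalSeries_pentagonal ℤ 0
  simp only [partitionSeries, PowerSeries.coeff_mk, h0, mul_one] at h1
  zify
  rw [eq_neg_of_add_eq_zero_right h1, ← Finset.sum_neg_distrib]
  refine Finset.sum_le_sum fun i _ ↦ ?_
  have h2 := neg_le_of_abs_le (abs_coeff_pentagonalSeries_le_one (n - i))
  nlinarith [Int.natCast_nonneg (partitionFn i)]

end PentagonalTruncation

section PackedTable

theorem partitionFn_zero : partitionFn 0 = 1 := by
  simp [partitionFn]

/-- If `t` is an inverse of the truncated pentagonal number series at `b`, and the base `b` digits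
of `t` are small, then these digits are the partition numbers. -/
theorem partitionFn_eq_digit {b J N M t : ℕ} (hb1 : 1 < b) (hN : N ≤ (2 * J + 1) * (3 * J + 1))
    (ht : pentagonalEven b J * t ≡ pentagonalOdd b J * t + 1 [MOD b ^ N])
    (hM : N * M < b) (hdigit : ∀ i < N, t / b ^ i % b ≤ M) {m : ℕ} (hm : m < N) :
    partitionFn m = t / b ^ m % b := by
  suffices H : ∀ m ≤ N, (∀ i < m, partitionFn i = t / b ^ i % b) ∧
      ∑ i ∈ Finset.range m, partitionFn i * b ^ i = t % b ^ m from (H N le_rfl).1 m hm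
  have hb : 0 < b := by omega
  intro m
  induction m with
  | zero => simp [Nat.mod_one]
  | succ m ih =>
    intro hm
    obtain ⟨ih1, ih2⟩ := ih (by omega)
    have hlt : partitionFn m < b := by
      rcases eq_or_ne m 0 with rfl | hm0
      · rw [partitionFn_zero]
        exact hb1
      · refine (partitionFn_le_sum_range hm0).trans_lt (lt_of_le_of_lt ?_ hM)
        calc ∑ i ∈ Finset.range m, partitionFn i ≤ ∑ i ∈ Finset.range m, M :=
              Finset.sum_le_sum fun i hi ↦ by
                rw [Finset.mem_range] at hi
                rw [ih1 i hi]
                exact hdigit i (by omega)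
          _ ≤ N * M := by
              rw [Finset.sum_const, Finset.card_range, smul_eq_mul]
              exact Nat.mul_le_mul_right _ (by omega)
    have hsum : ∑ i ∈ Finset.range (m + 1), partitionFn i * b ^ i < b ^ (m + 1) := by
      rw [Finset.sum_range_succ, ih2, pow_succ']
      have := Nat.mod_lt t (Nat.pow_pos (n := m) hb)
      nlinarith [Nat.pow_pos (n := m) hb]
    have heq : ∑ i ∈ Finset.range (m + 1), partitionFn i * b ^ i = t % b ^ (m + 1) := by
      have h1 := pow_dvd_sum_mul_sub_one (b := b) (hm.trans hN)
      have h2 : (b : ℤ) ^ (m + 1) ∣ (pentagonalEven b J - pentagonalOdd b J) * t - 1 := by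
        refine (pow_dvd_pow (b : ℤ) hm).trans ?_
        obtain ⟨c, hc⟩ := Nat.modEq_iff_dvd.1 ht
        push_cast at hc
        exact ⟨-c, by linear_combination -hc⟩
      have h3 : (∑ i ∈ Finset.range (m + 1), partitionFn i * b ^ i) ≡ t [MOD b ^ (m + 1)] := by
        rw [Nat.modEq_iff_dvd]
        push_cast
        obtain ⟨c, hc⟩ := h1
        obtain ⟨d, hd⟩ := h2
        exact ⟨(∑ i ∈ Finset.range (m + 1), (partitionFn i : ℤ) * b ^ i) * d - t * c,
          by linear_combination (∑ i ∈ Finset.range (m + 1), (partitionFn i : ℤ) * b ^ i) * hd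
            - t * hc⟩
      rw [← h3, Nat.mod_eq_of_lt hsum]
    refine ⟨fun i hi ↦ ?_, heq⟩
    rcases (Nat.lt_succ_iff.1 hi).lt_or_eq with h | rfl
    · exact ih1 i h
    · have h1 : t % b ^ i + partitionFn i * b ^ i = t % b ^ (i + 1) := by
        rw [← ih2, ← heq, Finset.sum_range_succ]
      have h2 := Nat.mod_pow_succ (x := t) (b := b) (k := i)
      rw [h2, mul_comm (b ^ i)] at h1
      exact Nat.eq_of_mul_eq_mul_right (Nat.pow_pos hb) (Nat.add_left_cancel h1)

end PackedTable

section FiniteRange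

/-- The base in which partition numbers are packed into a single natural number. -/
def radix : ℕ := 2 ^ 256

/-- Newton iteration for the inverse of the truncated pentagonal number series at `radix`. -/
def newtonInverse : ℕ → ℕ
  | 0 => 1
  | k + 1 => newtonInverse k * (2 + pentagonalOdd radix 27 * newtonInverse k +
      (radix ^ 2 ^ (k + 1) - pentagonalEven radix 27 * newtonInverse k % radix ^ 2 ^ (k + 1)))
        % radix ^ 2 ^ (k + 1)

/-- The partition numbers below `4170`, as digits in base `radix`. -/
def partitionTable : ℕ := newtonInverse 13

/-- Test all the four-digit windows of `t` with index in `[start, start + 64 * count)`. The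
two-level extraction keeps the intermediate numbers short. -/
def allWindows (t start count : ℕ) (f : ℕ → Bool) : Bool :=
  (List.range count).all fun c ↦ (List.range 64).all fun j ↦
    f (t / radix ^ (start + 64 * c) % radix ^ 68 / radix ^ j % radix ^ 4)

theorem apply_of_allWindows {t start count : ℕ} {f : ℕ → Bool} (h : allWindows t start count f)
    {i : ℕ} (hi : start ≤ i) (hi' : i < start + 64 * count) :
    f (t / radix ^ i % radix ^ 4) := by
  obtain ⟨c, j, hj, rfl⟩ : ∃ c j, j < 64 ∧ i = start + 64 * c + j :=
    ⟨(i - start) / 64, (i - start) % 64, Nat.mod_lt _ (by norm_num), by omega⟩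
  have h1 := List.all_eq_true.1 (List.all_eq_true.1 h c (List.mem_range.2 (by omega))) j
    (List.mem_range.2 hj)
  obtain ⟨l, hl⟩ : ∃ l, 68 = j + (4 + l) := ⟨64 - j, by omega⟩
  rwa [hl, pow_add radix j, Nat.mod_mul_right_div_self, pow_add radix 4,
    Nat.mod_mul_right_mod, Nat.div_div_eq_div_mul, ← pow_add] at h1

/-- The Turán inequality for the differences of the four digits of `u`. -/
def turanDigits (u : ℕ) : Bool :=
  decide (u % radix * (u / radix ^ 2 % radix) + u / radix % radix * (u / radix ^ 2 % radix)
    + u / radix % radix * (u / radix ^ 3 % radix) < (u / radix % radix) ^ 2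
    + (u / radix ^ 2 % radix) ^ 2 + u % radix * (u / radix ^ 3 % radix))

theorem partitionTable_modEq :
    pentagonalEven radix 27 * partitionTable ≡ pentagonalOdd radix 27 * partitionTable + 1
      [MOD radix ^ 4170] := by
  unfold Nat.ModEq
  decide +kernel

theorem allWindows_partitionTable_le :
    allWindows partitionTable 0 66 fun u ↦ decide (u % radix ≤ 2 ^ 240) := by
  decide +kernel

theorem allWindows_partitionTable_turan : allWindows partitionTable 70 64 turanDigits := by
  decide +kernel

theorem one_lt_radix : 1 < radix := by decide +kernel

theorem window_div_mod {t i k : ℕ} (hk : k < 4) :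
    t / radix ^ i % radix ^ 4 / radix ^ k % radix = t / radix ^ (i + k) % radix := by
  obtain ⟨l, hl⟩ : ∃ l, 4 = k + (1 + l) := ⟨3 - k, by omega⟩
  rw [hl, pow_add radix k, Nat.mod_mul_right_div_self, pow_add radix 1, pow_one,
    Nat.mod_mul_right_mod, Nat.div_div_eq_div_mul, ← pow_add]

theorem partitionFn_eq_digit_partitionTable {m : ℕ} (hm : m < 4170) :
    partitionFn m = partitionTable / radix ^ m % radix := by
  refine partitionFn_eq_digit (J := 27) (N := 4170) (M := 2 ^ 240) (t := partitionTable)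
    one_lt_radix (by norm_num) partitionTable_modEq (by decide +kernel) (fun i hi ↦ ?_) hm
  have h := of_decide_eq_true
    (apply_of_allWindows allWindows_partitionTable_le (Nat.zero_le i) (by omega))
  have h0 := window_div_mod (t := partitionTable) (i := i) (k := 0) (by norm_num)
  rw [pow_zero, Nat.div_one] at h0
  exact h0.ge.trans h

/-- The Turán inequality for the differences of the partition function, in the range covered by
the table. -/
theorem partitionFn_turan_of_small {n : ℕ} (hn : 70 ≤ n) (hn' : n < 4160) :
    partitionFn n * partitionFn (n + 2) + partitionFn (n + 1) * partitionFn (n + 2)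
      + partitionFn (n + 1) * partitionFn (n + 3)
      < partitionFn (n + 1) ^ 2 + partitionFn (n + 2) ^ 2
        + partitionFn n * partitionFn (n + 3) := by
  have h := of_decide_eq_true
    (apply_of_allWindows allWindows_partitionTable_turan hn (by omega))
  have h0 := window_div_mod (t := partitionTable) (i := n) (k := 0) (by norm_num)
  have h1 := window_div_mod (t := partitionTable) (i := n) (k := 1) (by norm_num)
  have h2 := window_div_mod (t := partitionTable) (i := n) (k := 2) (by norm_num)
  have h3 := window_div_mod (t := partitionTable) (i := n) (k := 3) (by norm_num)
  rw [pow_zero, Nat.div_one] at h0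
  rw [pow_one] at h1
  rw [h0, h1, h2, h3] at h
  rw [partitionFn_eq_digit_partitionTable (m := n) (by omega),
    partitionFn_eq_digit_partitionTable (m := n + 1) (by omega),
    partitionFn_eq_digit_partitionTable (m := n + 2) (by omega),
    partitionFn_eq_digit_partitionTable (m := n + 3) (by omega)]
  exact h

end FiniteRange

theorem turan_expanded_p (n : ℕ) (hn : 71 ≤ n) :
    ((partitionFn n : ℤ)) ^ 2 - partitionFn (n - 1) * partitionFn (n + 1)
      - partitionFn n * partitionFn (n + 1) + (partitionFn (n + 1) : ℤ) ^ 2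
      + partitionFn (n - 1) * partitionFn (n + 2)
      - partitionFn n * partitionFn (n + 2) > 0 := by
  obtain ⟨m, rfl⟩ : ∃ m, n = m + 1 := ⟨n - 1, by omega⟩
  rw [Nat.add_sub_cancel]
  rcases lt_or_ge m 4160 with h | h
  · have := partitionFn_turan_of_small (n := m) (by omega) h
    zify at this
    linarith
  · have := partitionFn_turan_of_large (n := m) (by omega)
    have h' : ((partitionFn (m + 1) : ℤ) - partitionFn m)
        * (partitionFn (m + 3) - partitionFn (m + 2))
        < ((partitionFn (m + 2) : ℤ) - partitionFn (m + 1)) ^ 2 := by exact_mod_cast this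
    linarith
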